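/- arXiv:2407.04030 — 3 statements merged into one kernel-verified Lean document; each statement's English description precedes it below -/
import Mathlib

section
/- Let A be a finite reflexive digraph with p vertices (equivalently, p loops) and m non-loop edges. For every k ≥ 1 and every finite reflexive digraph B there exists a finite reflexive digraph C such that for every coloring χ : Quot(C, A) → Fin k there exists a quotient map w : C → B for which the set {χ(f ∘ w) : f ∈ Quot(B, A)} has at most p!·m! elements. (Finite reflexive digraphs have dual small Ramsey degrees at most p!·m! with respect to quotient maps.) -/
/-- A quotient map between relational structures: a surjective map which preserves
and reflects the relation. -/
def IsQuot {V W : Type*} (ρ : V → V → Prop) (σ : W → W → Prop) (f : V → W) : Prop :=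
  Function.Surjective f ∧ (∀ x y, ρ x y → σ (f x) (f y)) ∧
    ∀ u v, σ u v → ∃ x y, ρ x y ∧ f x = u ∧ f y = v

/-- `w` is an (infinite) rigid surjection, with first occurrence function `φ`. -/
def Rig (w φ : ℕ → ℕ) : Prop :=
  StrictMono φ ∧ (∀ t, w (φ t) = t) ∧ ∀ t x, x < φ t → w x < t

/-- The word consisting of the first `i` values of `s`. -/
def Tr (s : ℕ → ℕ) (i : ℕ) : List ℕ := (List.range i).map s

theorem Tr_congr {s s' : ℕ → ℕ} {i : ℕ} (h : ∀ x < i, s x = s' x) : Tr s i = Tr s' i := by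
  unfold Tr
  apply List.map_congr_left
  intro a ha
  exact h a (List.mem_range.1 ha)

theorem Tr_length (s : ℕ → ℕ) (i : ℕ) : (Tr s i).length = i := by simp [Tr]

theorem Tr_getD (s : ℕ → ℕ) (i x d : ℕ) : (Tr s i).getD x d = if x < i then s x else d := by
  unfold Tr
  split_ifs with h
  · simp [List.getD, h]
  · simp [List.getD, h]

theorem Rig.id : Rig id id := ⟨strictMono_id, fun _ => rfl, fun _ _ h => h⟩

theorem Rig.comp {w φ w' φ' : ℕ → ℕ} (h : Rig w φ) (h' : Rig w' φ') : Rig (w ∘ w') (φ' ∘ φ) := by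
  refine ⟨h'.1.comp h.1, fun t => ?_, fun t x hx => ?_⟩
  · simp [h'.2.1, h.2.1]
  · exact h.2.2 _ _ (h'.2.2 _ _ hx)

/-- words over the alphabet `[0,l)`, starting with the identity. -/
def Yl (l : ℕ) (y : ℕ → ℕ) : Prop := (∀ t < l, y t = t) ∧ ∀ t, y t < l

theorem Rig.fix {w φ : ℕ → ℕ} (h : Rig w φ) {l : ℕ} (hl : ∀ t < l, φ t = t) :
    ∀ t < l, w t = t := by
  intro t ht
  have := h.2.1 t
  rwa [hl t ht] at this

theorem Yl.comp {l : ℕ} {y w φ : ℕ → ℕ} (hy : Yl l y) (h : Rig w φ) (hl : ∀ t < l, φ t = t) :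
    Yl l (y ∘ w) :=
  ⟨fun t ht => by simp [h.fix hl t ht, hy.1 t ht], fun t => hy.2 _⟩

/-- Hales-Jewett, multidimensional, with variables in order -/
theorem hj_lemma (l n : ℕ) (hn : 0 < n) (K : Type) [Finite K] :
    ∃ N, ∀ c : List ℕ → K, ∃ w φ, Rig w φ ∧ (∀ t < l, φ t = t) ∧ φ (l + n) ≤ N ∧
      ∀ y y', Yl l y → Yl l y' → c (Tr (y ∘ w) (φ (l + n))) = c (Tr (y' ∘ w) (φ (l + n))) := by
  classical
  obtain ⟨ι, hι, H⟩ := Combinatorics.Line.exists_mono_in_high_dimension (Fin n → Fin l) K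
  obtain ⟨r, ⟨e⟩⟩ : ∃ r, Nonempty (ι ≃ Fin r) := ⟨_, ⟨Fintype.equivFin ι⟩⟩
  -- the letter at position x
  refine ⟨l + r * n, fun c => ?_⟩
  let wd : (ι → Fin n → Fin l) → ℕ → ℕ := fun v x =>
    if x < l then x else if h : (x - l) / n < r then
      v (e.symm ⟨(x - l) / n, h⟩) ⟨(x - l) % n, Nat.mod_lt _ hn⟩ else 0
  obtain ⟨L, κ, hL⟩ := H (fun v => c (Tr (wd v) (l + r * n)))
  have hex : ∃ i : ℕ, ∃ h : i < r, L.idxFun (e.symm ⟨i, h⟩) = none := by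
    obtain ⟨i, hi⟩ := L.proper
    exact ⟨e i, (e i).2, by simpa using hi⟩
  let i0 := Nat.find hex
  obtain ⟨hi0, hi0'⟩ : ∃ h : i0 < r, L.idxFun (e.symm ⟨i0, h⟩) = none := Nat.find_spec hex
  have hmin : ∀ i, i < i0 → ∀ h : i < r, L.idxFun (e.symm ⟨i, h⟩) ≠ none := by
    intro i hi h h'
    exact Nat.find_min hex hi ⟨h, h'⟩
  clear_value i0
  let w : ℕ → ℕ := fun x => if x < l then x else if h : (x - l) / n < r then
      (match L.idxFun (e.symm ⟨(x - l) / n, h⟩) with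
        | some a => (a ⟨(x - l) % n, Nat.mod_lt _ hn⟩ : ℕ)
        | none => l + (x - l) % n) else l + n + (x - l - r * n)
  let φ : ℕ → ℕ := fun t => if t < l then t else if t < l + n then l + (i0 * n + (t - l)) else
    l + r * n + (t - l - n)
  have hdiv : ∀ x, (x - l) / n < r ↔ x - l < r * n := fun x => Nat.div_lt_iff_lt_mul hn
  have hmul : i0 * n + n ≤ r * n := by
    have := Nat.mul_le_mul_right n (Nat.succ_le_of_lt hi0)
    rwa [Nat.succ_mul] at this
  have hw1 : ∀ x < l, w x = x := fun x hx => by simp [w, hx]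
  have hw2 : ∀ x, l ≤ x → l + r * n ≤ x → w x = l + n + (x - l - r * n) := fun x hx h => by
    have h1 : ¬ x < l := by omega
    have h2 : ¬ (x - l) / n < r := by rw [hdiv]; omega
    simp only [w, h1, h2, if_false, dif_neg, not_false_eq_true]
  have hw3 : ∀ x, l ≤ x → x < l + r * n → w x < l ∨ w x = l + (x - l) % n ∧ i0 * n ≤ x - l := by
    intro x hx h
    have h1 : ¬ x < l := by omega
    have h2 : (x - l) / n < r := by rw [hdiv]; omega
    simp only [w, h1, h2, if_false, dif_pos]
    rcases hh : L.idxFun (e.symm ⟨(x - l) / n, h2⟩) with _ | a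
    · right
      refine ⟨by simp, ?_⟩
      by_contra hlt
      refine hmin ((x - l) / n) ?_ h2 hh
      rw [Nat.div_lt_iff_lt_mul hn]; omega
    · left
      simp
  have hw4 : ∀ s, s < n → w (l + (i0 * n + s)) = l + s := by
    intro s hs
    have h0 : l + (i0 * n + s) - l = i0 * n + s := by omega
    have h1 : ¬ l + (i0 * n + s) < l := by omega
    have h2 : (i0 * n + s) / n = i0 := by
      rw [Nat.mul_comm, Nat.mul_add_div hn, Nat.div_eq_of_lt hs, Nat.add_zero]
    have h3 : (i0 * n + s) % n = s := by
      rw [Nat.mul_comm, Nat.mul_add_mod, Nat.mod_eq_of_lt hs]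
    simp only [w, h0, h1, h2, h3, if_false, dif_pos hi0, hi0']
  have hmod : ∀ x, (x - l) % n < n := fun x => Nat.mod_lt _ hn
  refine ⟨w, φ, ⟨?_, ?_, ?_⟩, ?_, ?_, ?_⟩
  · intro a b hab
    simp only [φ]
    split_ifs <;> omega
  · intro t
    simp only [φ]
    split_ifs with h1 h2
    · exact hw1 t h1
    · rw [hw4 _ (by omega)]; omega
    · rw [hw2 _ (by omega) (by omega)]; omega
  · intro t x hx
    simp only [φ] at hx
    by_cases hxl : x < l
    · rw [hw1 x hxl]
      split_ifs at hx with h1 h2 <;> omega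
    · by_cases hx2 : x < l + r * n
      · have ht : ¬ t < l := by
          intro h; rw [if_pos h] at hx; omega
        rw [if_neg ht] at hx
        rcases hw3 x (by omega) hx2 with h | ⟨h, h'⟩
        · omega
        · have := hmod x
          split_ifs at hx with h2
          · obtain ⟨s, hs⟩ : ∃ s, x = l + (i0 * n + s) := ⟨x - l - i0 * n, by omega⟩
            rw [hs, hw4 _ (by omega)]; omega
          · omega
      · rw [hw2 x (by omega) (by omega)]
        split_ifs at hx with h1 h2 <;> omega
  · intro t ht
    simp [φ, ht]
  · have h1 : ¬ l + n < l := by omega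
    simp [φ]
  · have hφ : φ (l + n) = l + r * n := by simp [φ]
    have key : ∀ y, Yl l y → c (Tr (y ∘ w) (φ (l + n))) = κ := by
      intro y hy
      rw [← hL (fun s => ⟨y (l + s), hy.2 _⟩), hφ]
      congr 1
      apply Tr_congr
      intro x hx
      by_cases h1 : x < l
      · simp [wd, h1, hw1 x h1, hy.1 x h1]
      · have h2 : (x - l) / n < r := by rw [hdiv]; omega
        simp only [wd, w, h1, h2, if_false, dif_pos, Function.comp]
        rw [Combinatorics.Line.apply_def]
        rcases hh : L.idxFun (e.symm ⟨(x - l) / n, h2⟩) with _ | a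
        · simp [hh]
        · simp [hh, hy.1]
    intro y y' hy hy'
    rw [key y hy, key y' hy']

theorem q_lemma (l : ℕ) (hl : 0 < l) (K : Type) [Finite K] (M : ℕ) :
    ∃ N, ∀ c : List ℕ → K, ∃ w φ, Rig w φ ∧ (∀ t < l, φ t = t) ∧ φ (l + M) ≤ N ∧
      ∀ j, l ≤ j → j ≤ l + M → ∀ y y', Yl l y → Yl l y' →
        c (Tr (y ∘ w) (φ j)) = c (Tr (y' ∘ w) (φ j)) := by
  induction M with
  | zero =>
    refine ⟨l, fun c => ⟨id, id, Rig.id, fun _ _ => rfl, le_rfl, ?_⟩⟩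
    intro j hj hj' y y' hy hy'
    obtain rfl : j = l := by omega
    congr 1
    apply Tr_congr
    intro x hx
    simp only [Function.comp, id] at hx ⊢
    rw [hy.1 x hx, hy'.1 x hx]
  | succ M ih =>
    obtain ⟨N, hN⟩ := ih
    obtain ⟨N', hN'⟩ := hj_lemma l (N + 1) (by omega) K
    refine ⟨N', fun c => ?_⟩
    obtain ⟨W, Φ, hW, hΦl, hΦN, hc⟩ := hN' c
    obtain ⟨w, φ, hw, hφl, hφN, hcw⟩ := hN (fun L => c (Tr (fun x => L.getD (W x) 0) (Φ L.length)))
    have hT : ∀ s i, Tr (fun x => (Tr s i).getD (W x) 0) (Φ (Tr s i).length) = Tr (s ∘ W) (Φ i) := by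
      intro s i
      rw [Tr_length]
      apply Tr_congr
      intro x hx
      rw [Tr_getD, if_pos (hW.2.2 _ _ hx)]; rfl
    simp only [hT] at hcw
    -- add a new variable at position l + N
    let u : ℕ → ℕ := fun x => if x < l + N + 1 then min (w x) (l + M) else
      l + M + 1 + (x - (l + N + 1))
    let ψ : ℕ → ℕ := fun t => if t ≤ l + M then φ t else l + N + 1 + (t - (l + M + 1))
    have hmono := hw.1.monotone
    have hψ : Rig u ψ := by
      refine ⟨?_, ?_, ?_⟩
      · intro a b hab
        have h1 := hw.1 hab
        have h2 : a ≤ l + M → φ a ≤ φ (l + M) := fun h => hmono h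
        simp only [ψ]
        split_ifs <;> omega
      · intro t
        have h2 : t ≤ l + M → φ t ≤ φ (l + M) := fun h => hmono h
        have h3 := hw.2.1 t
        simp only [ψ]
        split_ifs with h
        · have := h2 h
          simp only [u]
          rw [if_pos (by omega)]; omega
        · simp only [u]
          rw [if_neg (by omega)]; omega
      · intro t x hx
        simp only [ψ] at hx
        simp only [u]
        have h2 : t ≤ l + M → φ t ≤ φ (l + M) := fun h => hmono h
        split_ifs at hx with h
        · have := hw.2.2 t x hx
          have := h2 h
          rw [if_pos (by omega)]; omega
        · split_ifs <;> omega
    have hψl : ∀ t < l, ψ t = t := fun t ht => by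
      simp only [ψ]; rw [if_pos (by omega), hφl t ht]
    refine ⟨u ∘ W, Φ ∘ ψ, hψ.comp hW, fun t ht => by simp [hψl t ht, hΦl t ht], ?_, ?_⟩
    · have : ψ (l + (M + 1)) = l + (N + 1) := by
        simp only [ψ]; rw [if_neg (by omega)]; omega
      simp only [Function.comp, this, hΦN]
    · intro j hj hj' y y' hy hy'
      by_cases hjM : j ≤ l + M
      · have h1 : ψ j = φ j := by simp only [ψ]; rw [if_pos hjM]
        have h2 : ∀ y, Tr (y ∘ u ∘ W) ((Φ ∘ ψ) j) = Tr ((y ∘ w) ∘ W) (Φ (φ j)) := by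
          intro y
          simp only [Function.comp_apply, h1]
          apply Tr_congr
          intro x hx
          have h3 := hW.2.2 _ _ hx
          have h4 := hw.2.2 _ _ h3
          have h5 := hmono hjM
          simp only [Function.comp, u]
          rw [if_pos (by omega), min_eq_left (by omega)]
        rw [h2, h2]
        exact hcw j hj hjM y y' hy hy'
      · have h1 : ψ j = l + (N + 1) := by simp only [ψ]; rw [if_neg hjM]; omega
        simp only [Function.comp_apply, h1]
        exact hc (y ∘ u) (y' ∘ u) (hy.comp hψ hψl) (hy'.comp hψ hψl)

theorem v_lemma (l : ℕ) (hl : 0 < l) (K : Type) [Finite K] (n : ℕ) :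
    ∃ N, ∀ c : List ℕ → K, ∃ w φ, Rig w φ ∧ (∀ t < l, φ t = t) ∧ φ (l + n) ≤ N ∧
      ∃ κ, ∀ j, l ≤ j → j ≤ l + n → ∀ y, Yl l y → c (Tr (y ∘ w) (φ j)) = κ := by
  classical
  have := Fintype.ofFinite K
  obtain ⟨N, hN⟩ := q_lemma l hl K (Fintype.card K * n)
  refine ⟨N, fun c => ?_⟩
  obtain ⟨w, φ, hw, hφl, hφN, hc⟩ := hN c
  let y0 : ℕ → ℕ := fun t => if t < l then t else 0
  have hy0 : Yl l y0 := ⟨fun t ht => by simp [y0, ht], fun t => by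
    simp only [y0]; split_ifs <;> omega⟩
  set M := Fintype.card K * n with hM
  let col : ℕ → K := fun j => c (Tr (y0 ∘ w) (φ (l + j)))
  obtain ⟨κ, -, hκ⟩ : ∃ κ ∈ (Finset.univ : Finset K), n < ((Finset.range (M + 1)).filter
      (fun j => col j = κ)).card := by
    apply Finset.exists_lt_card_fiber_of_mul_lt_card_of_maps_to
    · intro a _; exact Finset.mem_univ _
    · rw [Finset.card_range, Finset.card_univ]; omega
  let p : ℕ → Prop := fun j => col j = κ ∨ M < j
  have hp : {j | p j}.Infinite := by
    refine (Set.Ioi_infinite M).mono ?_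
    intro x hx; exact Or.inr hx
  have hcount : n < Nat.count p (M + 1) := by
    rw [Nat.count_eq_card_filter_range]
    refine lt_of_lt_of_le hκ (Finset.card_le_card ?_)
    intro x hx
    simp only [Finset.mem_filter] at hx ⊢
    exact ⟨hx.1, Or.inl hx.2⟩
  have hnth : ∀ t ≤ n, Nat.nth p t ≤ M := by
    intro t ht
    have : Nat.nth p t < M + 1 := Nat.nth_lt_of_lt_count (lt_of_le_of_lt ht hcount)
    omega
  have hcolt : ∀ t ≤ n, col (Nat.nth p t) = κ := by
    intro t ht
    rcases Nat.nth_mem_of_infinite hp t with h | h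
    · exact h
    · exact absurd (hnth t ht) (Nat.not_le_of_lt h)
  have hmn : StrictMono (Nat.nth p) := Nat.nth_strictMono hp
  clear hcount
  clear_value p
  -- the collapsing map
  let ψ : ℕ → ℕ := fun t => if t < l then t else l + Nat.nth p (t - l)
  let u : ℕ → ℕ := fun x => if x < l then x else
    if Nat.nth p 0 ≤ x - l then l + Nat.findGreatest (fun t => Nat.nth p t ≤ x - l) x else 0
  have hψ : Rig u ψ := by
    refine ⟨?_, ?_, ?_⟩
    · intro a b hab
      simp only [ψ]
      split_ifs with h1 h2
      · omega
      · omega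
      · omega
      · have := hmn (show a - l < b - l by omega)
        omega
    · intro t
      simp only [ψ]
      split_ifs with h1
      · simp [u, h1]
      · have h2 : ¬ l + Nat.nth p (t - l) < l := by omega
        have h3 : l + Nat.nth p (t - l) - l = Nat.nth p (t - l) := by omega
        have h4 : Nat.nth p 0 ≤ Nat.nth p (t - l) := hmn.monotone (by omega)
        simp only [u, h2, h3, h4, if_true, if_false]
        have : Nat.findGreatest (fun s => Nat.nth p s ≤ Nat.nth p (t - l))
            (l + Nat.nth p (t - l)) = t - l := by
          rw [Nat.findGreatest_eq_iff]
          refine ⟨?_, fun _ => le_rfl, ?_⟩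
          · have := hmn.le_apply (x := t - l)
            omega
          · intro s hs _ h
            have := hmn hs
            omega
        rw [this]; omega
    · intro t x hx
      simp only [ψ] at hx
      simp only [u]
      split_ifs at hx with h1
      · rw [if_pos (by omega)]; omega
      · split_ifs with h2 h3
        · omega
        · have h4 : Nat.nth p (Nat.findGreatest (fun t => Nat.nth p t ≤ x - l) x) ≤ x - l :=
            Nat.findGreatest_spec (P := fun t => Nat.nth p t ≤ x - l) (Nat.zero_le x) h3
          have h5 : Nat.nth p (Nat.findGreatest (fun t => Nat.nth p t ≤ x - l) x)
            < Nat.nth p (t - l) := by omega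
          have := hmn.lt_iff_lt.1 h5
          omega
        · omega
  have hψl : ∀ t < l, ψ t = t := fun t ht => by simp [ψ, ht]
  refine ⟨u ∘ w, φ ∘ ψ, hψ.comp hw, fun t ht => by simp [hψl t ht, hφl t ht], ?_, κ, ?_⟩
  · refine le_trans (hw.1.monotone ?_) hφN
    simp only [ψ]
    have := hnth n le_rfl
    rw [if_neg (by omega), Nat.add_sub_cancel_left]; omega
  · intro j hj hj' y hy
    have h1 : ψ j = l + Nat.nth p (j - l) := by simp only [ψ]; rw [if_neg (by omega)]
    have h2 := hnth (j - l) (by omega)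
    have h3 := hc (ψ j) (by omega) (by omega) (y ∘ u) y0 (hy.comp hψ hψl) hy0
    have h4 := hcolt (j - l) (by omega)
    simp only [col] at h4
    rw [← h1] at h4
    rw [← h4, ← h3]; rfl

theorem f_lemma (D : ℕ) (K : Type) [Finite K] (i : ℕ) : ∀ M,
    ∃ N, ∀ c : List ℕ → K, ∃ w φ, Rig w φ ∧ φ M ≤ N ∧
      ∀ i' < i, ∀ g g' : ℕ → ℕ, (∀ t, g t < D) → (∀ t ≤ i', g t = g' t) →
        (∀ t, ∃ s ≤ i', g t = g s) → (∀ t, ∃ s ≤ i', g' t = g' s) →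
        ∀ j j', i' < j → j ≤ M → i' < j' → j' ≤ M →
          c (Tr (g ∘ w) (φ j)) = c (Tr (g' ∘ w) (φ j')) := by
  induction i with
  | zero =>
    intro M
    exact ⟨M, fun c => ⟨id, id, Rig.id, le_rfl, fun i' hi' => by omega⟩⟩
  | succ i ih =>
    intro M
    obtain ⟨N0, hN0⟩ := v_lemma (i + 1) (by omega) ((Fin (i + 1) → Fin D) → K) M
    obtain ⟨N, hN⟩ := ih N0
    refine ⟨N, fun c => ?_⟩
    obtain ⟨W, Φ, hW, hΦN, hc⟩ := hN c
    let ext : (Fin (i + 1) → Fin D) → ℕ → ℕ := fun h x =>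
      if hx : x < i + 1 then h ⟨x, hx⟩ else 0
    obtain ⟨w, φ, hw, hφl, hφN, κ, hκ⟩ := hN0 (fun L h =>
      c (Tr (fun x => ext h (L.getD (W x) 0)) (Φ L.length)))
    have hwfix := hw.fix hφl
    have hφM : ∀ j ≤ M, φ j ≤ N0 := fun j hj =>
      le_trans (hw.1.monotone (by omega)) hφN
    refine ⟨w ∘ W, Φ ∘ φ, hw.comp hW, le_trans (hW.1.monotone (hφM M le_rfl)) hΦN, ?_⟩
    intro i' hi' g g' hgD hgg' hg hg' j j' hj hjM hj' hjM'
    by_cases hii : i' < i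
    · refine hc i' hii (g ∘ w) (g' ∘ w) (fun t => hgD _) ?_ ?_ ?_ (φ j) (φ j')
        (lt_of_lt_of_le hj hw.1.le_apply) (hφM j hjM) (lt_of_lt_of_le hj' hw.1.le_apply)
        (hφM j' hjM')
      · intro t ht
        simp only [Function.comp]
        rw [hwfix t (by omega)]; exact hgg' t ht
      · intro t
        obtain ⟨s, hs, h⟩ := hg (w t)
        refine ⟨s, hs, ?_⟩
        simp only [Function.comp]
        rw [hwfix s (by omega)]; exact h
      · intro t
        obtain ⟨s, hs, h⟩ := hg' (w t)
        refine ⟨s, hs, ?_⟩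
        simp only [Function.comp]
        rw [hwfix s (by omega)]; exact h
    · obtain rfl : i' = i := by omega
      let h : Fin (i' + 1) → Fin D := fun x => ⟨g x, hgD _⟩
      have key : ∀ f : ℕ → ℕ, (∀ t ≤ i', g t = f t) → (∀ t, ∃ s ≤ i', f t = f s) →
          ∀ j, i' < j → j ≤ M → c (Tr (f ∘ w ∘ W) ((Φ ∘ φ) j)) = κ h := by
        intro f hgf hf j hj hjM
        choose z hz hz' using hf
        let y : ℕ → ℕ := fun t => if t < i' + 1 then t else z t
        have hy : Yl (i' + 1) y := by
          refine ⟨fun t ht => if_pos ht, fun t => ?_⟩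
          simp only [y]
          have := hz t
          split_ifs <;> omega
        have hfy : ∀ t, ext h (y t) = f t := by
          intro t
          have : ext h (y t) = g (y t) := by
            simp only [ext]; rw [dif_pos (hy.2 t)]
          rw [this, hgf _ (Nat.lt_succ_iff.1 (hy.2 t))]
          simp only [y]
          split_ifs
          · rfl
          · exact (hz' t).symm
        rw [← hκ j hj (by omega) y hy]
        simp only [Tr_length]
        congr 1
        apply Tr_congr
        intro x hx
        have := hW.2.2 _ _ hx
        rw [Tr_getD, if_pos this]
        simp only [Function.comp, hfy]
      rw [key g' hgg' hg' j' hj' hjM', key g (fun _ _ => rfl) hg j hj hjM]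

/-- `h` restricted to `[0,j)` is a rigid surjection onto `[0,d)`. -/
def Rg (d j : ℕ) (h : ℕ → ℕ) : Prop :=
  (∀ x < j, h x < d) ∧ ∃ ψ : ℕ → ℕ, ∀ t < d, ψ t < j ∧ h (ψ t) = t ∧ ∀ x < ψ t, h x < t

theorem dual_ramsey (n : ℕ) (K : Type) [Finite K] (d : ℕ) :
    ∃ N, ∀ c : List ℕ → K, ∃ w φ, Rig w φ ∧ φ n ≤ N ∧
      ∃ κ, ∀ j ≤ n, ∀ h, Rg d j h → c (Tr (h ∘ w) (φ j)) = κ := by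
  induction d with
  | zero =>
    refine ⟨n, fun c => ⟨id, id, Rig.id, le_rfl, c [], ?_⟩⟩
    intro j hj h hh
    have : j = 0 := by
      by_contra h0
      have := hh.1 0 (by omega)
      omega
    subst this
    rfl
  | succ d ih =>
    obtain ⟨M, hM⟩ := ih
    obtain ⟨N, hN⟩ := f_lemma (d + 1) K M M
    refine ⟨N, fun c => ?_⟩
    obtain ⟨W, Φ, hW, hΦN, hc⟩ := hN c
    obtain ⟨w, φ, hw, hφM, κ, hκ⟩ := hM (fun L =>
      c (Tr (fun x => L.getD (W x) d) (Φ (L.length + 1))))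
    refine ⟨w ∘ W, Φ ∘ φ, hw.comp hW, le_trans (hW.1.monotone hφM) hΦN, κ, ?_⟩
    intro j hj h ⟨hlt, ψ, hψ⟩
    have hψd := hψ d (by omega)
    have hrg : Rg d (ψ d) h := by
      refine ⟨hψd.2.2, ψ, fun t ht => ?_⟩
      have h1 := hψ t (by omega)
      refine ⟨?_, h1.2⟩
      by_contra hle
      rcases Nat.lt_or_ge (ψ d) (ψ t) with h2 | h2
      · have := h1.2.2 _ h2
        omega
      · have : ψ t = ψ d := by omega
        rw [this] at h1
        omega
    rw [← hκ (ψ d) (by omega) h hrg]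
    simp only [Tr_length]
    set i := φ (ψ d) with hi
    let h' : ℕ → ℕ := fun x => if x < j then h x else d
    have hh' : ∀ t, ∃ s ≤ ψ d, h' t = h' s := by
      intro t
      have hval : ∃ v ≤ d, h' t = v := by
        simp only [h']
        split_ifs with ht
        · exact ⟨_, Nat.lt_succ_iff.1 (hlt t ht), rfl⟩
        · exact ⟨d, le_rfl, rfl⟩
      obtain ⟨v, hv, htv⟩ := hval
      have hv1 := hψ v (by omega)
      refine ⟨ψ v, ?_, ?_⟩
      · rcases Nat.lt_or_ge v d with h1 | h1
        · obtain ⟨ψ', h2⟩ := hrg.2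
          by_contra h3
          have := hv1.2.2 (ψ d) (by omega)
          omega
        · rw [show v = d by omega]
      · rw [htv]
        simp only [h']
        rw [if_pos hv1.1, hv1.2.1]
    have hij : i < φ j := hw.1 hψd.1
    have hjM : φ j ≤ M := le_trans (hw.1.monotone hj) hφM
    have e1 : Tr (h ∘ w ∘ W) ((Φ ∘ φ) j) = Tr ((h' ∘ w) ∘ W) (Φ (φ j)) := by
      apply Tr_congr
      intro x hx
      have := hw.2.2 _ _ (hW.2.2 _ _ hx)
      simp only [Function.comp, h']
      rw [if_pos this]
    have e2 : (fun x => (Tr (h ∘ w) i).getD (W x) d) = (fun x => (Tr (h ∘ w) i).getD x d) ∘ W := rfl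
    rw [e1, e2]
    refine hc i (by omega) _ _ ?_ ?_ ?_ ?_ _ _ hij hjM (by omega) (by omega)
    · intro t
      obtain ⟨s, hs, h1⟩ := hh' (w t)
      simp only [Function.comp, h']
      split_ifs with h2
      · exact hlt _ h2
      · omega
    · intro t ht
      rw [Tr_getD]
      simp only [Function.comp, h']
      rcases Nat.lt_or_ge t i with h1 | h1
      · have := hw.2.2 _ _ h1
        rw [if_pos h1, if_pos (by omega)]
      · obtain rfl : t = i := by omega
        rw [if_neg (lt_irrefl i), show w i = ψ d from hw.2.1 _, if_pos hψd.1]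
        exact hψd.2.1
    · intro t
      obtain ⟨s, hs, h1⟩ := hh' (w t)
      refine ⟨φ s, hw.1.monotone hs, ?_⟩
      simp only [Function.comp]
      rw [hw.2.1]; exact h1
    · intro t
      rcases Nat.lt_or_ge t i with h1 | h1
      · exact ⟨t, h1.le, rfl⟩
      · refine ⟨i, le_rfl, ?_⟩
        rw [Tr_getD, Tr_getD, if_neg (by omega), if_neg (by omega)]

theorem exists_sorting {X : Type} [Fintype X] (p : ℕ) (hp : Fintype.card X = p) (r : X → ℕ)
    (hr : Function.Injective r) : ∃ σ : Fin p ≃ X, StrictMono (r ∘ σ) := by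
  classical
  let _ : LinearOrder X := LinearOrder.lift' r hr
  refine ⟨(Fintype.orderIsoFinOfCardEq X hp).toEquiv, fun a b hab => ?_⟩
  have : (Fintype.orderIsoFinOfCardEq X hp) a < (Fintype.orderIsoFinOfCardEq X hp) b :=
    (Fintype.orderIsoFinOfCardEq X hp).strictMono hab
  exact this

/-- non-loop edges -/
abbrev NL {A : Type} (ρ : A → A → Prop) : Type := {e : A × A // ρ e.1 e.2 ∧ e.1 ≠ e.2}

open Classical in
/-- enumeration of all edges: first the loops, then the non-loop edges -/
noncomputable def edgeEnum {A : Type} {ρ : A → A → Prop} {p m : ℕ} (a0 : A) (σ : Fin p ≃ A)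
    (τ : Fin m ≃ NL ρ) (t : ℕ) : A × A :=
  if h : t < p then (σ ⟨t, h⟩, σ ⟨t, h⟩) else
    if h' : t - p < m then (τ ⟨t - p, h'⟩).1 else (a0, a0)

section
variable {A : Type} {ρ : A → A → Prop} {p m : ℕ} (a0 : A) (σ : Fin p ≃ A) (τ : Fin m ≃ NL ρ)

theorem edgeEnum_rel (hρ : Reflexive ρ) (t : ℕ) :
    ρ (edgeEnum a0 σ τ t).1 (edgeEnum a0 σ τ t).2 := by
  unfold edgeEnum
  split_ifs with h h'
  · exact hρ _
  · exact (τ ⟨t - p, h'⟩).2.1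
  · exact hρ _

theorem edgeEnum_loop {t : ℕ} (h : t < p) :
    edgeEnum a0 σ τ t = (σ ⟨t, h⟩, σ ⟨t, h⟩) := by
  unfold edgeEnum
  rw [dif_pos h]

theorem edgeEnum_nonloop {t : ℕ} (h : ¬ t < p) (h' : t - p < m) :
    edgeEnum a0 σ τ t = (τ ⟨t - p, h'⟩).1 := by
  unfold edgeEnum
  rw [dif_neg h, dif_pos h']

theorem edgeEnum_surj_loop (u : A) : ∃ t < p, edgeEnum a0 σ τ t = (u, u) := by
  refine ⟨σ.symm u, (σ.symm u).2, ?_⟩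
  rw [edgeEnum_loop a0 σ τ (σ.symm u).2]
  simp

theorem edgeEnum_surj (u v : A) (huv : ρ u v) : ∃ t < p + m, edgeEnum a0 σ τ t = (u, v) := by
  by_cases h : u = v
  · subst h
    obtain ⟨t, ht, h⟩ := edgeEnum_surj_loop a0 σ τ u
    exact ⟨t, by omega, h⟩
  · let x := τ.symm ⟨(u, v), huv, h⟩
    refine ⟨p + x, by omega, ?_⟩
    have h1 : p + (x : ℕ) - p = x := by omega
    rw [edgeEnum_nonloop a0 σ τ (by omega) (by omega)]
    simp [h1, x]

theorem edgeEnum_inj {s t : ℕ} (hs : s < p + m) (ht : t < p + m)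
    (h : edgeEnum a0 σ τ s = edgeEnum a0 σ τ t) : s = t := by
  by_cases h1 : s < p <;> by_cases h2 : t < p
  · rw [edgeEnum_loop a0 σ τ h1, edgeEnum_loop a0 σ τ h2] at h
    have := σ.injective (Prod.ext_iff.1 h).1
    simpa using this
  · rw [edgeEnum_loop a0 σ τ h1, edgeEnum_nonloop a0 σ τ h2 (by omega)] at h
    have := (τ ⟨t - p, by omega⟩).2.2
    rw [← h] at this
    exact absurd rfl this
  · rw [edgeEnum_loop a0 σ τ h2, edgeEnum_nonloop a0 σ τ h1 (by omega)] at h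
    have := (τ ⟨s - p, by omega⟩).2.2
    rw [h] at this
    exact absurd rfl this
  · rw [edgeEnum_nonloop a0 σ τ h1 (by omega), edgeEnum_nonloop a0 σ τ h2 (by omega)] at h
    have := τ.injective (Subtype.ext h)
    simp at this
    omega
end

theorem exists_rigid {A B : Type} [Fintype A] {ρA : A → A → Prop} {ρB : B → B → Prop}
    {p m q M : ℕ} (hp : Fintype.card A = p) (hm : Nat.card (NL ρA) = m)
    (hA : Reflexive ρA) (hB : Reflexive ρB) (a0 : A) (b0 : B)
    (σB : Fin q ≃ B) (τB : Fin M ≃ NL ρB) (f : B → A) (hf : IsQuot ρB ρA f) :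
    ∃ (σ : Fin p ≃ A) (τ : Fin m ≃ NL ρA) (h : ℕ → ℕ), Rg (p + m) (q + M) h ∧
      ∀ t < q + M, edgeEnum a0 σ τ (h t) = Prod.map f f (edgeEnum b0 σB τB t) := by
  classical
  let G : ℕ → A × A := fun t => Prod.map f f (edgeEnum b0 σB τB t)
  have hGρ : ∀ t, ρA (G t).1 (G t).2 := fun t => hf.2.1 _ _ (edgeEnum_rel b0 σB τB hB t)
  have hloop : ∀ a, ∃ t, t < q ∧ G t = (a, a) := by
    intro a
    obtain ⟨b, rfl⟩ := hf.1 a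
    obtain ⟨t, ht, h⟩ := edgeEnum_surj_loop b0 σB τB b
    exact ⟨t, ht, by simp [G, h]⟩
  have hedge : ∀ e : NL ρA, ∃ t, t < q + M ∧ G t = e.1 := by
    rintro ⟨⟨u, v⟩, huv, hne⟩
    obtain ⟨x, y, hxy, rfl, rfl⟩ := hf.2.2 u v huv
    obtain ⟨t, ht, h⟩ := edgeEnum_surj b0 σB τB x y hxy
    exact ⟨t, ht, by simp [G, h]⟩
  let r1 : A → ℕ := fun a => Nat.find (hloop a)
  let r2 : NL ρA → ℕ := fun e => Nat.find (hedge e)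
  have hr1 : ∀ a, r1 a < q ∧ G (r1 a) = (a, a) := fun a => Nat.find_spec (hloop a)
  have hr2 : ∀ e, r2 e < q + M ∧ G (r2 e) = e.1 := fun e => Nat.find_spec (hedge e)
  have hr1m : ∀ a x, x < r1 a → G x ≠ (a, a) := fun a x hx h =>
    Nat.find_min (hloop a) hx ⟨lt_trans hx (hr1 a).1, h⟩
  have hr2m : ∀ e x, x < r2 e → G x ≠ e.1 := fun e x hx h =>
    Nat.find_min (hedge e) hx ⟨lt_trans hx (hr2 e).1, h⟩
  have hr2q : ∀ e, q ≤ r2 e := by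
    intro e
    by_contra hlt
    have h1 := (hr2 e).2
    have h2 := e.2.2
    simp only [G] at h1
    rw [edgeEnum_loop b0 σB τB (by omega)] at h1
    rw [← h1] at h2
    exact h2 rfl
  obtain ⟨σ, hσ⟩ := exists_sorting p hp r1 (fun a b hab => by
    have h1 := (hr1 a).2
    rw [hab, (hr1 b).2] at h1
    exact (Prod.ext_iff.1 h1).1.symm)
  obtain ⟨τ, hτ⟩ := exists_sorting m (by rw [← hm, Nat.card_eq_fintype_card]) r2
    (fun a b hab => by
      have h1 := (hr2 a).2
      rw [hab, (hr2 b).2] at h1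
      exact Subtype.ext h1.symm)
  have hh : ∀ t, ∃ s < p + m, edgeEnum a0 σ τ s = G t := fun t =>
    edgeEnum_surj a0 σ τ _ _ (hGρ t)
  choose h hlt hG using hh
  let ψ : ℕ → ℕ := fun s => if hs : s < p then r1 (σ ⟨s, hs⟩) else
    if hs' : s - p < m then r2 (τ ⟨s - p, hs'⟩) else 0
  have hψ1 : ∀ s (hs : s < p), ψ s = r1 (σ ⟨s, hs⟩) := fun s hs => by
    simp only [ψ]; rw [dif_pos hs]
  have hψ2 : ∀ s (hs : ¬ s < p) (hs' : s - p < m), ψ s = r2 (τ ⟨s - p, hs'⟩) := fun s hs hs' => by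
    simp only [ψ]; rw [dif_neg hs, dif_pos hs']
  have hψ : ∀ s < p + m, ψ s < q + M ∧ G (ψ s) = edgeEnum a0 σ τ s ∧
      ∀ x < ψ s, G x ≠ edgeEnum a0 σ τ s := by
    intro s hs
    by_cases h1 : s < p
    · rw [hψ1 s h1, edgeEnum_loop a0 σ τ h1]
      have := hr1 (σ ⟨s, h1⟩)
      exact ⟨by omega, this.2, hr1m _⟩
    · rw [hψ2 s h1 (by omega), edgeEnum_nonloop a0 σ τ h1 (by omega)]
      exact ⟨(hr2 _).1, (hr2 _).2, hr2m _⟩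
  have hψm : ∀ s t, s < t → t < p + m → ψ s < ψ t := by
    intro s t hst ht
    by_cases h1 : t < p
    · rw [hψ1 t h1, hψ1 s (by omega)]
      exact hσ (by simpa using hst)
    · rw [hψ2 t h1 (by omega)]
      by_cases h2 : s < p
      · rw [hψ1 s h2]
        exact lt_of_lt_of_le (hr1 _).1 (hr2q _)
      · rw [hψ2 s h2 (by omega)]
        apply hτ
        simp only [Fin.mk_lt_mk]
        omega
  refine ⟨σ, τ, h, ⟨fun x _ => hlt x, ψ, fun s hs => ⟨(hψ s hs).1, ?_, ?_⟩⟩, fun t _ => hG t⟩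
  · apply edgeEnum_inj a0 σ τ (hlt _) hs
    rw [hG, (hψ s hs).2.1]
  · intro x hx
    by_contra hge
    have h1 : ψ s ≤ ψ (h x) := by
      rcases Nat.lt_or_ge s (h x) with h2 | h2
      · exact (hψm _ _ h2 (hlt x)).le
      · rw [show h x = s by omega]
    exact (hψ (h x) (hlt x)).2.2 x (by omega) (hG x).symm

theorem stmt_9 (A : Type) [Fintype A] (ρA : A → A → Prop) (hA : Reflexive ρA)
    (p m : ℕ) (hp : Fintype.card A = p)
    (hm : {e : A × A | ρA e.1 e.2 ∧ e.1 ≠ e.2}.ncard = m)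
    (k : ℕ) (hk : 1 ≤ k)
    (B : Type) [Fintype B] (ρB : B → B → Prop) (hB : Reflexive ρB) :
    ∃ (C : Type) (ρC : C → C → Prop), Finite C ∧ Reflexive ρC ∧
      ∀ χ : {f : C → A // IsQuot ρC ρA f} → Fin k,
        ∃ w : C → B, IsQuot ρC ρB w ∧
          {c : Fin k | ∃ g : {f : C → A // IsQuot ρC ρA f},
              (∃ f : B → A, IsQuot ρB ρA f ∧ g.1 = f ∘ w) ∧ χ g = c}.ncard ≤
            Nat.factorial p * Nat.factorial m := by
  classical
  have hpos : 0 < Nat.factorial p * Nat.factorial m :=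
    Nat.mul_pos (Nat.factorial_pos _) (Nat.factorial_pos _)
  by_cases hsub : Subsingleton (B → A)
  · refine ⟨B, ρB, inferInstance, hB, fun χ => ⟨id, ⟨Function.surjective_id, fun _ _ h => h,
      fun u v h => ⟨u, v, h, rfl, rfl⟩⟩, le_trans ?_ hpos⟩⟩
    rw [Set.ncard_le_one]
    rintro a ⟨g, -, rfl⟩ b ⟨g', -, rfl⟩
    rw [show g = g' from Subtype.ext (Subsingleton.elim _ _)]
  have hBne : Nonempty B := by
    by_contra h
    rw [not_nonempty_iff] at h
    exact hsub inferInstance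
  have hAne : Nonempty A := by
    by_contra h
    rw [not_nonempty_iff] at h
    exact hsub inferInstance
  obtain ⟨a0⟩ := hAne
  obtain ⟨b0⟩ := hBne
  have hm' : Nat.card (NL ρA) = m := by rw [← hm]; rfl
  let q := Fintype.card B
  let M := Fintype.card (NL ρB)
  have σB : Fin q ≃ B := (Fintype.equivFin B).symm
  have τB : Fin M ≃ NL ρB := (Fintype.equivFin (NL ρB)).symm
  have hq : 0 < q := Fintype.card_pos_iff.2 ⟨b0⟩
  have hp0 : 0 < p := hp ▸ Fintype.card_pos_iff.2 ⟨a0⟩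
  let n := q + M
  let S := (Fin p ≃ A) × (Fin m ≃ NL ρA)
  have hS : Fintype.card S = Nat.factorial p * Nat.factorial m := by
    simp only [S, Fintype.card_prod]
    rw [Fintype.card_equiv (Fintype.equivFinOfCardEq hp).symm,
      Fintype.card_equiv (Fintype.equivFinOfCardEq (by rw [← hm', Nat.card_eq_fintype_card])).symm]
    simp
  obtain ⟨N, hN⟩ := dual_ramsey n (S → Fin k) (p + m)
  let pick : {X : Type} → X × X → Bool → X := fun e b => if b then e.2 else e.1
  let ρC : Fin N × Bool → Fin N × Bool → Prop := fun x y =>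
    x = y ∨ (x.1 = y.1 ∧ x.2 = false ∧ y.2 = true)
  refine ⟨Fin N × Bool, ρC, inferInstance, fun x => Or.inl rfl, fun χ => ?_⟩
  let χ' : (Fin N × Bool → A) → Fin k := fun f => if h : IsQuot ρC ρA f then χ ⟨f, h⟩ else ⟨0, hk⟩
  obtain ⟨w, φ, hw, hφN, κ, hκ⟩ := hN (fun L s => χ' (fun x =>
    pick (edgeEnum a0 s.1 s.2 (L.getD x.1 0)) x.2))
  let W : Fin N × Bool → B := fun x =>
    pick (edgeEnum b0 σB τB (if x.1 < φ n then w x.1 else 0)) x.2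
  have hW : IsQuot ρC ρB W := by
    have h1 : ∀ t < n, ∃ x : Fin N, (if (x : ℕ) < φ n then w x else 0) = t := by
      intro t ht
      have := hw.1 ht
      exact ⟨⟨φ t, by omega⟩, by simp only [this, if_true, hw.2.1]⟩
    refine ⟨?_, ?_, ?_⟩
    · intro b
      obtain ⟨t, ht, h⟩ := edgeEnum_surj_loop b0 σB τB b
      obtain ⟨x, hx⟩ := h1 t (by omega)
      exact ⟨(x, false), by simp only [W, hx, h, pick]; rfl⟩
    · rintro x y (rfl | ⟨h1, h2, h3⟩)
      · exact hB _
      · simp only [W, pick, h1, h2, h3]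
        exact edgeEnum_rel b0 σB τB hB _
    · intro u v huv
      obtain ⟨t, ht, h⟩ := edgeEnum_surj b0 σB τB u v huv
      obtain ⟨x, hx⟩ := h1 t ht
      refine ⟨(x, false), (x, true), Or.inr ⟨rfl, rfl, rfl⟩, ?_, ?_⟩
      · simp only [W, hx, h, pick]; rfl
      · simp only [W, hx, h, pick]; rfl
  refine ⟨W, hW, ?_⟩
  have hsubset : {c : Fin k | ∃ g : {f : Fin N × Bool → A // IsQuot ρC ρA f},
              (∃ f : B → A, IsQuot ρB ρA f ∧ g.1 = f ∘ W) ∧ χ g = c} ⊆ Set.range κ := by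
    rintro c ⟨g, ⟨f, hf, hgf⟩, rfl⟩
    obtain ⟨σ, τ, h, hh, hhe⟩ := exists_rigid hp hm' hA hB a0 b0 σB τB f hf
    refine ⟨(σ, τ), ?_⟩
    rw [← hκ n le_rfl h hh]
    have h0 : h 0 = 0 := by
      obtain ⟨-, ψ, hψ⟩ := hh
      obtain ⟨-, h1, h2⟩ := hψ 0 (by omega)
      have : ψ 0 = 0 := by
        by_contra hne
        have := h2 0 (by omega)
        omega
      rwa [this] at h1
    have hfun : (fun x : Fin N × Bool => pick (edgeEnum a0 σ τ ((Tr (h ∘ w) (φ n)).getD x.1 0)) x.2)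
        = g.1 := by
      rw [hgf]
      funext ⟨x, b⟩
      have e1 : (Tr (h ∘ w) (φ n)).getD x 0 = h (if (x : ℕ) < φ n then w x else 0) := by
        rw [Tr_getD]
        split_ifs
        · rfl
        · exact h0.symm
      have e2 : (if (x : ℕ) < φ n then w x else 0) < n := by
        split_ifs with hx
        · exact hw.2.2 _ _ hx
        · omega
      simp only [e1, Function.comp, W]
      rw [hhe _ e2]
      cases b <;> simp [pick]
    simp only [hfun, χ']
    rw [dif_pos g.2]
  refine le_trans (Set.ncard_le_ncard hsubset (Set.finite_range κ)) ?_
  rw [← hS, ← Nat.card_eq_fintype_card, ← Set.ncard_univ, ← Set.image_univ]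
  exact Set.ncard_image_le
end

section
/- Let A be a finite partial order (a reflexive, antisymmetric, transitive digraph) with p elements and m non-loop edges (pairs (x, y) with x ≤ y and x ≠ y). For every k ≥ 1 and every finite partial order B there exists a finite partial order C such that for every coloring χ : Quot(C, A) → Fin k there exists a quotient map w : C → B for which the set {χ(f ∘ w) : f ∈ Quot(B, A)} has at most p!·m! elements. (Finite partial orders have dual small Ramsey degrees at most p!·m! with respect to quotient maps.) -/
/-- A partial order relation: reflexive, antisymmetric and transitive. -/
def IsPO {V : Type*} (ρ : V → V → Prop) : Prop :=
  Reflexive ρ ∧ AntiSymmetric ρ ∧ Transitive ρ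

inductive PW : ℕ → ℕ → List ℕ → Prop
  | nil (s : ℕ) : PW s s []
  | old {s t x : ℕ} {l : List ℕ} : x < s → PW s t l → PW s t (x :: l)
  | new {s t : ℕ} {l : List ℕ} : PW (s+1) t l → PW s t (s :: l)

def wsub (F w : List ℕ) : List ℕ := w.map (fun x => F.getD x 0)

@[simp] lemma wsub_nil (F) : wsub F [] = [] := rfl
@[simp] lemma wsub_cons (F x w) : wsub F (x :: w) = F.getD x 0 :: wsub F w := rfl
@[simp] lemma wsub_append (F v w) : wsub F (v ++ w) = wsub F v ++ wsub F w := by simp [wsub]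
@[simp] lemma wsub_length (F w) : (wsub F w).length = w.length := by simp [wsub]

lemma wsub_congr {F G w : List ℕ} (h : ∀ x ∈ w, F.getD x 0 = G.getD x 0) : wsub F w = wsub G w :=
  List.map_congr_left h

lemma wsub_getD (F G : List ℕ) (x : ℕ) (h : x < G.length) :
    (wsub F G).getD x 0 = F.getD (G.getD x 0) 0 := by
  simp [wsub, List.getD, h]

lemma wsub_sub (F G w : List ℕ) (h : ∀ x ∈ w, x < G.length) :
    wsub F (wsub G w) = wsub (wsub F G) w := by
  unfold wsub
  rw [List.map_map]
  apply List.map_congr_left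
  intro x hx
  exact (wsub_getD F G x (h x hx)).symm

lemma wsub_range (F : List ℕ) (s : ℕ) (h : ∀ x < s, F.getD x 0 = x) :
    wsub F (List.range s) = List.range s := by
  unfold wsub
  conv_rhs => rw [← List.map_id (List.range s)]
  apply List.map_congr_left
  intro x hx
  exact h x (List.mem_range.1 hx)

lemma range_getD (s x : ℕ) (l : List ℕ) (h : x < s) : (List.range s ++ l).getD x 0 = x := by
  rw [List.getD_append _ _ _ _ (by simpa using h)]
  simp [List.getD, h]

lemma app_getD (P : List ℕ) (t : ℕ) (hP : P.length = t) (a : ℕ) (l : List ℕ) :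
    (P ++ a :: l).getD t 0 = a := by
  subst hP; simp [List.getD]

lemma wsub_range_app (s : ℕ) (l : List ℕ) : wsub (List.range s ++ l) (List.range s) = List.range s :=
  wsub_range _ _ (fun x hx => range_getD s x l hx)

namespace PW
lemma le {s t l} (h : PW s t l) : s ≤ t := by
  induction h with
  | nil => exact le_rfl
  | old _ _ ih => exact ih
  | new _ ih => omega

lemma lt {s t l} (h : PW s t l) : ∀ x ∈ l, x < t := by
  induction h with
  | nil => simp
  | old h1 h2 ih =>
    intro x hx
    rcases List.mem_cons.1 hx with rfl | hx
    · exact lt_of_lt_of_le h1 h2.le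
    · exact ih x hx
  | new h2 ih =>
    intro x hx
    rcases List.mem_cons.1 hx with rfl | hx
    · exact h2.le
    · exact ih x hx

lemma append {s t u l l'} (h : PW s t l) (h' : PW t u l') : PW s u (l ++ l') := by
  induction h with
  | nil => exact h'
  | old h1 h2 ih => exact .old h1 (ih h')
  | new h2 ih => exact .new (ih h')

lemma const {s : ℕ} {l : List ℕ} (h : ∀ x ∈ l, x < s) : PW s s l := by
  induction l with
  | nil => exact .nil s
  | cons a l ih => exact .old (h a (by simp)) (ih fun x hx => h x (by simp [hx]))

lemma surj {s t l} (h : PW s t l) : ∀ x, s ≤ x → x < t → x ∈ l := by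
  induction h with
  | nil => intros; omega
  | old h1 h2 ih => intro x h3 h4; exact List.mem_cons_of_mem _ (ih x h3 h4)
  | @new s t l h2 ih =>
    intro x h3 h4
    rcases eq_or_lt_of_le h3 with rfl | h5
    · simp
    · exact List.mem_cons_of_mem _ (ih x h5 h4)

lemma comp {a b v} (hv : PW a b v) : ∀ {G u : List ℕ} {t t' : ℕ}, G.length = a →
    (∀ x ∈ G, x < t) → PW t t' u → a + u.length = b → PW t t' (wsub (G ++ u) v) := by
  induction hv with
  | nil s =>
    intro G u t t' h1 h2 h3 h4
    have : u = [] := List.length_eq_zero_iff.1 (by omega)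
    subst this
    exact h3
  | @old s t x l hx hl ih =>
    intro G u t t' h1 h2 h3 h4
    refine .old ?_ (ih h1 h2 h3 h4)
    beta_reduce
    rw [List.getD_append _ _ _ _ (by omega), List.getD_eq_getElem _ _ (by omega)]
    exact h2 _ (List.getElem_mem _)
  | @new s b l hl ih =>
    intro G u t t' h1 h2 h3 h4
    have := hl.le
    cases h3 with
    | nil => simp at h4; omega
    | @old _ _ y u hy hu =>
      rw [wsub_cons, app_getD G s h1]
      refine .old hy ?_
      rw [List.append_cons]
      refine ih (by simp [h1]) ?_ hu (by simp at h4; omega)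
      intro x hx
      rcases List.mem_append.1 hx with hx | hx
      · exact h2 x hx
      · simp at hx; omega
    | @new _ _ u hu =>
      rw [wsub_cons, app_getD G s h1]
      refine .new ?_
      rw [List.append_cons]
      refine ih (by simp [h1]) ?_ hu (by simp at h4; omega)
      intro x hx
      rcases List.mem_append.1 hx with hx | hx
      · exact (h2 x hx).trans (by omega)
      · simp at hx; omega

lemma split {s t l} (h : PW s t l) (hst : s < t) :
    ∃ g h', l = g ++ s :: h' ∧ (∀ x ∈ g, x < s) ∧ PW (s+1) t h' := by
  induction h with
  | nil => omega
  | @old s t x l h1 h2 ih =>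
    obtain ⟨g, h', rfl, h3, h4⟩ := ih hst
    exact ⟨x :: g, h', rfl, by simpa using ⟨h1, h3⟩, h4⟩
  | @new s t l h2 ih => exact ⟨[], l, rfl, by simp, h2⟩
end PW

/-- words of length `n` over the alphabet `M` -/
def Wd (n M : ℕ) : Type := {l : List ℕ // l.length ≤ n ∧ ∀ x ∈ l, x < M}

instance (n M : ℕ) : Finite (Wd n M) := by
  have h := (List.finite_length_le (Fin M) n).image (List.map Fin.val)
  apply Set.Finite.subset h
  rintro l ⟨h1, h2⟩
  refine ⟨l.pmap (fun x hx => ⟨x, hx⟩) h2, by simpa using h1, ?_⟩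
  simp [List.map_pmap]

lemma hj1 (s : ℕ) (κ : Type) [Finite κ] : ∃ n, ∀ c : List ℕ → κ, ∃ w : List ℕ, w.length = n ∧
    (∀ y ∈ w, y ≤ s) ∧ s ∈ w ∧ ∃ z, ∀ x < s, c (wsub (List.range s ++ [x]) w) = z := by
  obtain ⟨ι, hι, H⟩ := Combinatorics.Line.exists_mono_in_high_dimension (Fin s) κ
  let e := Fintype.equivFin ι
  refine ⟨Fintype.card ι, fun c => ?_⟩
  obtain ⟨L, z, hz⟩ := H (fun f => c (List.ofFn fun i => (f (e.symm i)).val))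
  refine ⟨List.ofFn fun i => (L.idxFun (e.symm i)).elim s Fin.val, by simp, ?_, ?_, z, ?_⟩
  · intro y hy
    rw [List.mem_ofFn] at hy
    obtain ⟨i, rfl⟩ := hy
    cases L.idxFun (e.symm i) with
    | none => simp
    | some a => simp
  · rw [List.mem_ofFn]
    obtain ⟨i, hi⟩ := L.proper
    exact ⟨e i, by simp [hi]⟩
  · intro x hx
    rw [← hz ⟨x, hx⟩]
    congr 1
    unfold wsub
    rw [List.map_ofFn]
    congr 1
    funext i
    simp only [Function.comp]
    rw [Combinatorics.Line.coe_apply]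
    cases h : L.idxFun (e.symm i) with
    | none => simp [List.getD]
    | some a => simpa using range_getD s a _ a.2

lemma shift_PW {s k T : ℕ} {u : List ℕ} (hu : PW s (s+k) u) :
    T = s + 1 + k → PW (s+1) T (wsub (List.range s ++ List.range' (s+1) k) u) := by
  rintro rfl
  refine hu.comp (by simp) (fun x hx => by simp at hx; omega) ?_ (by simp)
  clear hu
  generalize s + 1 = a
  induction k generalizing a with
  | zero => exact .nil _
  | succ k ih =>
    rw [List.range'_succ]
    refine .new ?_
    have := ih (a+1)
    rwa [show a + (k+1) = a + 1 + k by omega]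

lemma getD_range' (P : List ℕ) (a : ℕ) (hP : P.length = a) (l : List ℕ) :
    wsub (P ++ l) (List.range' a l.length) = l := by
  induction l generalizing P a with
  | nil => simp
  | cons x l ih =>
    rw [List.length_cons, List.range'_succ, wsub_cons, app_getD P a hP, List.append_cons,
      ih _ _ (by simp [hP])]

lemma wsub_shift {s k x : ℕ} {u l : List ℕ} (hu : ∀ y ∈ u, y < s + k) (hl : l.length = k) :
    wsub (List.range s ++ x :: l) (wsub (List.range s ++ List.range' (s+1) k) u)
      = wsub (List.range s ++ l) u := by
  rw [wsub_sub _ _ _ (by simpa using hu), wsub_append, wsub_range_app]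
  subst hl
  rw [List.append_cons, getD_range' _ _ (by simp)]

lemma line_split {s : ℕ} {w : List ℕ} (h : ∀ y ∈ w, y ≤ s) (hs : s ∈ w) :
    ∃ a b, w = a ++ s :: b ∧ (∀ x ∈ a, x < s) ∧ ∀ x ∈ b, x < s + 1 := by
  obtain ⟨a, b, rfl, hab⟩ := List.eq_append_cons_of_mem hs
  refine ⟨a, b, rfl, fun x hx => ?_, fun x hx => ?_⟩
  · have := h x (by simp [hx])
    rcases eq_or_lt_of_le this with rfl | h'
    · exact absurd hx hab
    · exact h'
  · have := h x (by simp [hx])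
    omega

lemma line_PW {s : ℕ} {w : List ℕ} (h : ∀ y ∈ w, y ≤ s) (hs : s ∈ w) : PW s (s+1) w := by
  obtain ⟨a, b, rfl, ha, hb⟩ := line_split h hs
  exact (PW.const ha).append (.new (PW.const hb))

lemma line_wsub {s x : ℕ} {l w : List ℕ} (h : ∀ y ∈ w, y ≤ s) :
    wsub (List.range s ++ x :: l) w = wsub (List.range s ++ [x]) w := by
  apply wsub_congr
  intro y hy
  rcases eq_or_lt_of_le (h y hy) with rfl | h'
  · rw [app_getD _ _ (by simp), app_getD _ _ (by simp)]
  · rw [range_getD _ _ _ h', range_getD _ _ _ h']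

lemma wsub_lt {F : List ℕ} {M : ℕ} (hF : ∀ y ∈ F, y < M) (hM : 0 < M) (w : List ℕ) :
    ∀ y ∈ wsub F w, y < M := by
  intro y hy
  obtain ⟨x, _, rfl⟩ := List.mem_map.1 hy
  by_cases h : x < F.length
  · rw [List.getD_eq_getElem _ _ h]; exact hF _ (List.getElem_mem _)
  · rw [List.getD_eq_default _ _ (by omega)]; exact hM

def GR (s d : ℕ) : Prop := ∀ (κ : Type) [Finite κ] (k : ℕ), ∃ n, ∀ c : List ℕ → κ,
  ∃ w, PW s (s+k) w ∧ w.length = n ∧ ∃ z, ∀ h, PW s (s+d) h → h.length = k →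
    c (wsub (List.range s ++ h) w) = z

lemma gr_zero (s : ℕ) (hs : 1 ≤ s) : GR s 0 := by
  intro κ _ k
  induction k with
  | zero =>
    exact ⟨0, fun c => ⟨[], .nil _, rfl, c [], fun h _ _ => rfl⟩⟩
  | succ k ih =>
    obtain ⟨N, hN⟩ := ih
    obtain ⟨n1, hn1⟩ := hj1 s (Wd N s → κ)
    refine ⟨n1 + N, fun c => ?_⟩
    obtain ⟨w1, hl1, hle1, hs1, z, hz⟩ := hn1 (fun l r => c (l ++ r.1))
    obtain ⟨u, hu, hul, z', hz'⟩ := hN (fun l => c (wsub (List.range s ++ [0]) w1 ++ l))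
    refine ⟨w1 ++ wsub (List.range s ++ List.range' (s+1) k) u, ?_, by simp [hl1, hul], z', ?_⟩
    · exact (line_PW hle1 hs1).append (shift_PW hu (by omega))
    · intro h hh hk
      obtain ⟨x, h', rfl⟩ : ∃ x h', h = x :: h' := List.exists_cons_of_length_eq_add_one hk
      have hlt := hh.lt
      have hx : x < s := hlt x (by simp)
      have hk' : h'.length = k := by simpa using hk
      have hlt' : ∀ y ∈ h', y < s := fun y hy => hlt y (by simp [hy])
      rw [wsub_append, line_wsub hle1, wsub_shift hu.lt hk',
        ← hz' h' (PW.const hlt') hk']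
      have hF : ∀ y ∈ List.range s ++ h', y < s := by
        intro y hy
        rcases List.mem_append.1 hy with hy | hy
        · simpa using hy
        · exact hlt' y hy
      let r : Wd N s := ⟨wsub (List.range s ++ h') u, by simp [hul], wsub_lt hF hs u⟩
      exact (congrFun (hz x hx) r).trans (congrFun (hz 0 hs) r).symm

/-- The vector step: make the colour of prefixes constant. -/
lemma vec (s : ℕ) (hs : 1 ≤ s) (κ : Type) [Finite κ] [DecidableEq κ] (S : ℕ) : ∀ f : κ → ℕ,
    (∑ᶠ i, f i = S) → ∃ K, ∀ c : List ℕ → κ, ∃ i u, PW s (s + f i) u ∧ u.length = K ∧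
      ∀ g h T, (∀ x ∈ g, x < s) → PW (s+1) T h → g.length + 1 + h.length = f i →
        ∃ G H, wsub (List.range s ++ (g ++ s :: h)) u = G ++ s :: H ∧ (∀ x ∈ G, x < s) ∧
          PW (s+1) T H ∧ c G = i := by
  cases nonempty_fintype κ
  induction S with
  | zero =>
    intro f hf
    refine ⟨0, fun c => ?_⟩
    have h0 : f (c []) = 0 := by
      rw [finsum_eq_sum_of_fintype] at hf
      exact Finset.sum_eq_zero_iff.1 hf _ (Finset.mem_univ _)
    refine ⟨c [], [], by rw [h0]; exact .nil _, rfl, ?_⟩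
    intro g h T _ _ h3
    omega
  | succ S ih =>
    intro f hf
    by_cases hpos : ∃ i, f i = 0
    · obtain ⟨i, hi⟩ := hpos
      refine ⟨0, fun c => ⟨i, [], by rw [hi]; exact .nil _, rfl, ?_⟩⟩
      intro g h T _ _ h3
      omega
    push Not at hpos
    have key : ∀ i, ∑ᶠ j, Function.update f i (f i - 1) j = S := by
      intro i
      rw [finsum_eq_sum_of_fintype] at hf ⊢
      rw [Finset.sum_update_of_mem (Finset.mem_univ i)]
      have := Finset.add_sum_erase Finset.univ f (Finset.mem_univ i)
      rw [Finset.sdiff_singleton_eq_erase]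
      have := hpos i
      omega
    choose Kf hKf using fun i => ih _ (key i)
    let N := ∑ i, Kf i
    have hKN : ∀ i, Kf i ≤ N := fun i =>
      Finset.single_le_sum (f := Kf) (fun _ _ => Nat.zero_le _) (Finset.mem_univ i)
    obtain ⟨n1, hn1⟩ := hj1 s (Wd N s → κ)
    refine ⟨n1 + N, fun c => ?_⟩
    obtain ⟨w1, hl1, hle1, hs1, z, hz⟩ := hn1 (fun l r => c (l ++ r.1))
    obtain ⟨a, b, hab, ha, hb⟩ := line_split hle1 hs1
    obtain ⟨i, hi⟩ : ∃ i, i = c a := ⟨_, rfl⟩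
    obtain ⟨j, u0, hu0, hu0l, H0⟩ := hKf i (fun l => c (wsub (List.range s ++ [0]) w1 ++ l))
    -- pad
    obtain ⟨u, hu, hul, H⟩ : ∃ u, PW s (s + Function.update f i (f i - 1) j) u ∧ u.length = N ∧
      ∀ g h T, (∀ x ∈ g, x < s) → PW (s+1) T h →
        g.length + 1 + h.length = Function.update f i (f i - 1) j →
        ∃ G H, wsub (List.range s ++ (g ++ s :: h)) u = G ++ s :: H ∧ (∀ x ∈ G, x < s) ∧
          PW (s+1) T H ∧ c (wsub (List.range s ++ [0]) w1 ++ G) = j := by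
      refine ⟨u0 ++ List.replicate (N - Kf i) 0, hu0.append (PW.const ?_), ?_, ?_⟩
      · intro x hx; rw [List.eq_of_mem_replicate hx]; omega
      · have := hKN i
        simp [hu0l]; omega
      · intro g h T h1 h2 h3
        obtain ⟨G, H, e1, e2, e3, e4⟩ := H0 g h T h1 h2 h3
        refine ⟨G, H ++ wsub (List.range s ++ (g ++ s :: h)) (List.replicate (N - Kf i) 0),
          by rw [wsub_append, e1]; simp, e2, e3.append (PW.const ?_), e4⟩
        intro y hy
        obtain ⟨x, hx, rfl⟩ := List.mem_map.1 hy
        rw [List.eq_of_mem_replicate hx, range_getD _ _ _ (by omega)]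
        have := e3.le; omega
    have hsame : ∀ x < s, ∀ l, l.length ≤ N → (∀ y ∈ l, y < s) →
        c (wsub (List.range s ++ [x]) w1 ++ l) = c (wsub (List.range s ++ [0]) w1 ++ l) := by
      intro x hx l h1 h2
      exact (congrFun (hz x hx) ⟨l, h1, h2⟩).trans (congrFun (hz 0 hs) ⟨l, h1, h2⟩).symm
    have hw1lt : ∀ x < s, ∀ y ∈ wsub (List.range s ++ [x]) w1, y < s := by
      intro x hx
      apply wsub_lt _ hs
      intro y hy
      rcases List.mem_append.1 hy with hy | hy
      · simpa using hy
      · simp at hy; omega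
    by_cases hij : j = i
    · subst hij
      rw [Function.update_self] at hu H
      obtain ⟨q, hq⟩ : ∃ q, f j = q + 1 := ⟨f j - 1, by have := hpos j; omega⟩
      rw [hq, Nat.add_sub_cancel] at hu H
      refine ⟨j, w1 ++ wsub (List.range s ++ List.range' (s+1) q) u, ?_, by simp [hl1, hul], ?_⟩
      · exact (line_PW hle1 hs1).append (shift_PW hu (by omega))
      · intro g h T h1 h2 h3
        rw [hq] at h3
        cases g with
        | nil =>
          simp only [List.nil_append, List.length_nil] at h3 ⊢
          rw [wsub_append, wsub_shift hu.lt (by omega), line_wsub hle1]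
          have ew : wsub (List.range s ++ [s]) w1 = w1 := by
            rw [← List.range_succ]
            unfold wsub
            conv_rhs => rw [← List.map_id w1]
            apply List.map_congr_left
            intro x hx
            have := hle1 x hx
            simpa using range_getD (s+1) x [] (by omega)
          rw [ew]
          refine ⟨a, b ++ wsub (List.range s ++ h) u, by rw [hab]; simp, ha,
            (PW.const hb).append ?_, hi.symm⟩
          exact hu.comp (by simp) (fun x hx => by simp at hx; omega) h2 (by omega)
        | cons x g =>
          have hx : x < s := h1 x (by simp)
          obtain ⟨G, H', e1, e2, e3, e4⟩ := H g h T (fun y hy => h1 y (by simp [hy])) h2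
            (by simp at h3; omega)
          have hlen := congrArg List.length e1
          simp [hul] at hlen
          refine ⟨wsub (List.range s ++ [x]) w1 ++ G, H', ?_, ?_, e3, ?_⟩
          · rw [List.cons_append, wsub_append, wsub_shift hu.lt (by simp at h3 ⊢; omega),
              line_wsub hle1, e1, List.append_assoc]
          · intro y hy
            rcases List.mem_append.1 hy with hy | hy
            · exact hw1lt x hx y hy
            · exact e2 y hy
          · rw [hsame x hx G (by omega) e2, e4]
    · rw [Function.update_of_ne hij] at hu H
      refine ⟨j, wsub (List.range s ++ [0]) w1 ++ u, (PW.const (hw1lt 0 hs)).append hu,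
        by simp [hl1, hul], ?_⟩
      intro g h T h1 h2 h3
      obtain ⟨G, H', e1, e2, e3, e4⟩ := H g h T h1 h2 h3
      refine ⟨wsub (List.range s ++ [0]) w1 ++ G, H', ?_, ?_, e3, e4⟩
      · rw [wsub_append, e1, List.append_assoc]
        congr 1
        conv_rhs => rw [← List.map_id (wsub (List.range s ++ [0]) w1)]
        apply List.map_congr_left
        intro y hy
        exact range_getD _ _ _ (hw1lt 0 hs y hy)
      · intro y hy
        rcases List.mem_append.1 hy with hy | hy
        · exact hw1lt 0 hs y hy
        · exact e2 y hy

lemma fusion (s d : ℕ) (hs : 1 ≤ s) (hGR : GR (s+1) d) (κ : Type) [Finite κ] (K : ℕ) :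
    ∀ t, s ≤ t → ∃ n, ∀ c : List ℕ → List ℕ → κ, ∃ w, PW t (t+K) w ∧ w.length = n ∧
      ∀ P, P.length = t → (∀ x < s, P.getD x 0 = x) → (∀ x ∈ P, x < s) →
      ∀ g, (∀ x ∈ g, x < s) → ∀ h h', PW (s+1) (s+1+d) h → PW (s+1) (s+1+d) h' →
        g.length + 1 + h.length = K → g.length + 1 + h'.length = K →
        c P (wsub (P ++ (g ++ s :: h)) w) = c P (wsub (P ++ (g ++ s :: h')) w) := by
  induction K with
  | zero =>
    intro t _
    refine ⟨0, fun c => ⟨[], .nil _, rfl, ?_⟩⟩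
    intros; omega
  | succ K ih =>
    intro t hst
    obtain ⟨N, hN⟩ := ih (t+1) (by omega)
    obtain ⟨n', hn'⟩ := hGR (Wd t s → κ) N
    refine ⟨n' + 1, fun c => ?_⟩
    obtain ⟨v, hv, hvl, z, hz⟩ := hn' (fun l P => c P.1 (s :: l))
    obtain ⟨u, hu, hul, H⟩ := hN (fun P' l => c (P'.take t)
      (P'.getD t 0 :: wsub (List.range s ++ P'.getD t 0 :: l) v))
    have hvlt := hv.lt
    refine ⟨t :: wsub (List.range s ++ t :: u) v, ?_, by simp [hvl], ?_⟩
    · refine .new ?_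
      rw [List.append_cons]
      rw [show t + (K+1) = t+1+K by omega]
      refine hv.comp (by simp) ?_ hu (by omega)
      intro x hx
      simp at hx; omega
    · intro P hPl hPr hPs g hg h h' hh hh' hk hk'
      have expand : ∀ a l, wsub (P ++ a :: l) (t :: wsub (List.range s ++ t :: u) v) =
          a :: wsub (List.range s ++ a :: wsub (P ++ a :: l) u) v := by
        intro a l
        rw [wsub_cons, app_getD P t hPl, wsub_sub, wsub_append, wsub_cons, app_getD P t hPl,
          wsub_range]
        · intro x hx
          rw [List.getD_append _ _ _ _ (by omega)]
          exact hPr x hx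
        · intro x hx
          have := hvlt x hx
          simp [hul]; omega
      cases g with
      | nil =>
        simp only [List.nil_append, List.length_nil] at hk hk' ⊢
        rw [expand, expand]
        have aux : ∀ h, PW (s+1) (s+1+d) h → 0 + 1 + h.length = K + 1 →
            c P (s :: wsub (List.range s ++ s :: wsub (P ++ s :: h) u) v) =
              z ⟨P, hPl.le, hPs⟩ := by
          intro h hh hk
          rw [← hz (wsub (P ++ s :: h) u) ?_ (by simp [hul])]
          · rw [List.range_succ, List.append_assoc]; rfl
          · rw [List.append_cons]
            refine hu.comp (by simp [hPl]) ?_ hh (by omega)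
            intro x hx
            rcases List.mem_append.1 hx with hx | hx
            · have := hPs x hx; omega
            · simp at hx; omega
        rw [aux h hh hk, aux h' hh' hk']
      | cons a g =>
        have ha : a < s := hg a (by simp)
        simp only [List.cons_append, List.length_cons] at hk hk' ⊢
        rw [expand, expand]
        have := H (P ++ [a]) (by simp [hPl]) ?_ ?_ g (fun y hy => hg y (by simp [hy])) h h' hh hh'
          (by omega) (by omega)
        · rw [app_getD P t hPl, List.take_left' hPl, ← List.append_cons, ← List.append_cons] at this
          exact this
        · intro x hx
          rw [List.getD_append _ _ _ _ (by omega)]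
          exact hPr x hx
        · intro x hx
          rcases List.mem_append.1 hx with hx | hx
          · exact hPs x hx
          · simp at hx; omega

lemma gr_step (s d : ℕ) (hs : 1 ≤ s) (hGR : GR (s+1) d) : GR s (d+1) := by
  classical
  intro κ _ k
  obtain ⟨K, hK⟩ := vec s hs κ _ (fun _ => k) rfl
  obtain ⟨n, hn⟩ := fusion s d hs hGR κ K s le_rfl
  refine ⟨n, fun c => ?_⟩
  obtain ⟨w, hw, hwl, Hw⟩ := hn (fun _ l => c l)
  let h0 : ℕ → List ℕ := fun m =>
    if hh : ∃ h, PW (s+1) (s+1+d) h ∧ h.length = m then hh.choose else []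
  have hh0 : ∀ h, PW (s+1) (s+1+d) h → PW (s+1) (s+1+d) (h0 h.length) ∧
      (h0 h.length).length = h.length := by
    intro h hh
    have hex : ∃ h', PW (s+1) (s+1+d) h' ∧ h'.length = h.length := ⟨h, hh, rfl⟩
    simp only [h0, dif_pos hex]
    exact hex.choose_spec
  obtain ⟨i, u, hu, hul, Hu⟩ := hK
    (fun G => c (wsub (List.range s ++ (G ++ s :: h0 (K - 1 - G.length))) w))
  refine ⟨wsub (List.range s ++ u) w, ?_, by simp [hwl], i, ?_⟩
  · exact hw.comp (by simp) (fun x hx => by simpa using hx) hu (by omega)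
  · intro h hh hk
    obtain ⟨g, h', rfl, hg, hh'⟩ := hh.split (by omega)
    obtain ⟨G, H, e1, e2, e3, e4⟩ := Hu g h' _ hg hh' (by simp at hk; omega)
    have hwlt := hw.lt
    rw [wsub_sub _ _ _ (by simpa [hul] using hwlt), wsub_append, wsub_range_app, e1, ← e4]
    rw [show s + (d+1) = s+1+d by omega] at e3
    have hlen := congrArg List.length e1
    simp [hul] at hlen
    have hHl : H.length = K - 1 - G.length := by omega
    obtain ⟨q1, q2⟩ := hh0 H e3
    rw [← hHl]
    exact Hw (List.range s) (by simp) (fun x hx => by simpa using range_getD s x [] hx)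
      (fun x hx => by simpa using hx) G e2 _ _ e3 q1 (by omega) (by omega)

lemma gr (d : ℕ) : ∀ s, 1 ≤ s → GR s d := by
  induction d with
  | zero => exact gr_zero
  | succ d ih => exact fun s hs => gr_step s d hs (ih (s+1) (by omega))

/-- Dual Ramsey theorem -/
lemma dual_ramsey_s10 (κ : Type) [Finite κ] (a b : ℕ) (ha : 1 ≤ a) (hb : 1 ≤ b) :
    ∃ n, ∀ c : List ℕ → κ, ∃ w, PW 0 b w ∧ w.length = n ∧ ∃ z, ∀ h, PW 0 a h → h.length = b →
      c (wsub h w) = z := by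
  obtain ⟨n, hn⟩ := gr (a-1) 1 le_rfl κ (b-1)
  refine ⟨n+1, fun c => ?_⟩
  obtain ⟨w, hw, hwl, z, hz⟩ := hn (fun l => c (0 :: l))
  rw [show 1 + (b-1) = b by omega] at hw
  refine ⟨0 :: w, .new hw, by simp [hwl], z, ?_⟩
  intro h hh hl
  cases hh with
  | nil => omega
  | old h1 => omega
  | new h1 =>
    exact hz _ (by rwa [show 1 + (a-1) = a by omega]) (by simp at hl; omega)

/-- first-occurrence normal form of a list -/
lemma normal {α : Type} (d : α) (L : List α) : ∀ τ : List α, τ.Nodup →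
    ∃ σ r, (τ ++ σ).Nodup ∧ PW τ.length (τ ++ σ).length r ∧ L ⊆ τ ++ σ ∧ σ ⊆ L ∧
      L = r.map (fun i => (τ ++ σ).getD i d) := by
  classical
  induction L with
  | nil => intro τ hτ; exact ⟨[], [], by simpa using hτ, by simpa using PW.nil _, by simp, by simp, rfl⟩
  | cons x L ih =>
    intro τ hτ
    by_cases hx : x ∈ τ
    · obtain ⟨σ, r, h1, h2, h3, h4, h5⟩ := ih τ hτ
      obtain ⟨i, hi, rfl⟩ := List.mem_iff_getElem.1 hx
      refine ⟨σ, i :: r, h1, .old hi h2, ?_, fun y hy => List.mem_cons_of_mem _ (h4 hy), ?_⟩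
      · exact List.cons_subset.2 ⟨by simp, h3⟩
      · rw [List.map_cons, ← h5, List.getD_append _ _ _ _ hi, List.getD_eq_getElem _ _ hi]
    · obtain ⟨σ, r, h1, h2, h3, h4, h5⟩ := ih (τ ++ [x]) (by
        rw [List.nodup_append]
        refine ⟨hτ, by simp, ?_⟩
        intro a ha b hb
        simp at hb
        rintro rfl
        subst hb; exact hx ha)
      rw [← List.append_cons] at h1 h2 h3 h5
      refine ⟨x :: σ, τ.length :: r, h1, .new (by simpa using h2), ?_, ?_, ?_⟩
      · exact List.cons_subset.2 ⟨by simp, h3⟩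
      · exact List.cons_subset.2 ⟨by simp, fun y hy => List.mem_cons_of_mem _ (h4 hy)⟩
      · rw [List.map_cons, ← h5]
        congr 1
        simp [List.getD]

/-- disjoint union of `n` two-element chains -/
def chainRel (n : ℕ) (x y : Fin n × Bool) : Prop := x.1 = y.1 ∧ x.2 ≤ y.2

lemma chain_po (n : ℕ) : IsPO (chainRel n) := by
  refine ⟨fun x => ⟨rfl, le_rfl⟩, ?_, ?_⟩
  · rintro x y ⟨h1, h2⟩ ⟨_, h3⟩
    exact Prod.ext h1 (le_antisymm h2 h3)
  · rintro x y z ⟨h1, h2⟩ ⟨h3, h4⟩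
    exact ⟨h1.trans h3, h2.trans h4⟩

/-- the map on chains given by a list of edges -/
def chainMap {V : Type} (n : ℕ) (d : V × V) (L : List (V × V)) (x : Fin n × Bool) : V :=
  if x.2 then (L.getD x.1 d).2 else (L.getD x.1 d).1

lemma chain_quot {V : Type} (ρ : V → V → Prop) (hρ : IsPO ρ) (n : ℕ) (d : V × V)
    (L : List (V × V)) (hL : L.length = n) (h1 : ∀ e ∈ L, ρ e.1 e.2)
    (h2 : ∀ u v, ρ u v → (u, v) ∈ L) : IsQuot (chainRel n) ρ (chainMap n d L) := by
  have h3 : ∀ u v, ρ u v → ∃ x y, chainRel n x y ∧ chainMap n d L x = u ∧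
      chainMap n d L y = v := by
    intro u v huv
    obtain ⟨i, hi, he⟩ := List.mem_iff_getElem.1 (h2 u v huv)
    refine ⟨(⟨i, by omega⟩, false), (⟨i, by omega⟩, true), ⟨rfl, by simp⟩, ?_, ?_⟩ <;>
      simp [chainMap, List.getD, hi, he]
  refine ⟨fun u => ?_, ?_, h3⟩
  · obtain ⟨x, _, _, hx, _⟩ := h3 u u (hρ.1 u)
    exact ⟨x, hx⟩
  · rintro ⟨i, a⟩ ⟨j, b⟩ ⟨h4, h5⟩
    simp only at h4 h5
    subst h4
    have hi : (i : ℕ) < L.length := by rw [hL]; exact i.2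
    have := h1 _ (List.getElem_mem hi)
    cases a <;> cases b <;> simp [chainMap, List.getD, hi] at * <;>
      first | exact hρ.1 _ | exact this | exact absurd h5 (by decide)

lemma getD_map_lt {α β : Type} (f : α → β) (L : List α) (d : α) (d' : β) (i : ℕ)
    (h : i < L.length) : (L.map f).getD i d' = f (L.getD i d) := by
  simp [List.getD, h]

theorem stmt_10 (A : Type) [Fintype A] (ρA : A → A → Prop) (hA : IsPO ρA)
    (p m : ℕ) (hp : Fintype.card A = p)
    (hm : {e : A × A | ρA e.1 e.2 ∧ e.1 ≠ e.2}.ncard = m)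
    (k : ℕ) (hk : 1 ≤ k)
    (B : Type) [Fintype B] (ρB : B → B → Prop) (hB : IsPO ρB) :
    ∃ (C : Type) (ρC : C → C → Prop), Finite C ∧ IsPO ρC ∧
      ∀ χ : {f : C → A // IsQuot ρC ρA f} → Fin k,
        ∃ w : C → B, IsQuot ρC ρB w ∧
          {c : Fin k | ∃ g : {f : C → A // IsQuot ρC ρA f},
              (∃ f : B → A, IsQuot ρB ρA f ∧ g.1 = f ∘ w) ∧ χ g = c}.ncard ≤
            Nat.factorial p * Nat.factorial m := by
  classical
  have hid : IsQuot ρB ρB id :=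
    ⟨Function.surjective_id, fun _ _ h => h, fun u v h => ⟨u, v, h, rfl, rfl⟩⟩
  have hfac : 1 ≤ Nat.factorial p * Nat.factorial m :=
    Nat.mul_pos (Nat.factorial_pos _) (Nat.factorial_pos _)
  rcases isEmpty_or_nonempty B with hBe | ⟨⟨b0⟩⟩
  · refine ⟨B, ρB, inferInstance, hB, fun χ => ⟨id, hid, le_trans ?_ hfac⟩⟩
    rw [Set.ncard_le_one_iff]
    rintro c c' ⟨g, _, rfl⟩ ⟨g', _, rfl⟩
    congr 1
    exact Subtype.ext (Subsingleton.elim _ _)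
  rcases isEmpty_or_nonempty A with hAe | ⟨⟨a0⟩⟩
  · refine ⟨B, ρB, inferInstance, hB, fun χ => ⟨id, hid, le_trans ?_ hfac⟩⟩
    rw [Set.ncard_le_one_iff]
    rintro c c' ⟨g, _, rfl⟩
    exact (hAe.false (g.1 b0)).elim
  -- edges
  let lA : List (A × A) := (Finset.univ.filter (fun e : A × A => e.1 = e.2)).toList
  let nA : List (A × A) := (Finset.univ.filter (fun e : A × A => ρA e.1 e.2 ∧ e.1 ≠ e.2)).toList
  let lB : List (B × B) := (Finset.univ.filter (fun e : B × B => e.1 = e.2)).toList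
  let nB : List (B × B) := (Finset.univ.filter (fun e : B × B => ρB e.1 e.2 ∧ e.1 ≠ e.2)).toList
  have mlA : ∀ e, e ∈ lA ↔ e.1 = e.2 := by intro e; simp [lA]
  have mnA : ∀ e, e ∈ nA ↔ ρA e.1 e.2 ∧ e.1 ≠ e.2 := by intro e; simp [nA]
  have mlB : ∀ e, e ∈ lB ↔ e.1 = e.2 := by intro e; simp [lB]
  have mnB : ∀ e, e ∈ nB ↔ ρB e.1 e.2 ∧ e.1 ≠ e.2 := by intro e; simp [nB]
  have dlA : lA.Nodup := Finset.nodup_toList _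
  have dnA : nA.Nodup := Finset.nodup_toList _
  have cnA : nA.length = m := by
    rw [← hm, Finset.length_toList, ← Set.ncard_coe_finset]
    congr 1
    ext e
    simp
  have clA : lA.length = p := by
    rw [← hp, Finset.length_toList, ← Finset.card_univ (α := A)]
    symm
    refine Finset.card_bij (fun a _ => (a, a)) ?_ ?_ ?_
    · simp
    · intro a _ a' _ h; exact (Prod.ext_iff.1 h).1
    · rintro ⟨a, b⟩ h
      simp at h
      exact ⟨a, by simp, by rw [h]⟩
  let S : Finset (List (A × A) × List (A × A)) :=
    lA.permutations.toFinset ×ˢ nA.permutations.toFinset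
  have hScard : S.card ≤ Nat.factorial p * Nat.factorial m := by
    rw [Finset.card_product]
    refine Nat.mul_le_mul ?_ ?_
    · refine (List.toFinset_card_le _).trans ?_
      rw [List.length_permutations, clA]
    · refine (List.toFinset_card_le _).trans ?_
      rw [List.length_permutations, cnA]
  have hlB1 : 1 ≤ (lB ++ nB).length := by
    have : (b0, b0) ∈ lB ++ nB := List.mem_append_left _ ((mlB _).2 rfl)
    exact List.length_pos_of_mem this
  have hlA1 : 1 ≤ p + m := by
    have : (a0, a0) ∈ lA := (mlA _).2 rfl
    have := List.length_pos_of_mem this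
    omega
  obtain ⟨n, hn⟩ := dual_ramsey_s10 (S → Fin k) (p+m) (lB ++ nB).length hlA1 hlB1
  refine ⟨Fin n × Bool, chainRel n, inferInstance, chain_po n, fun χ => ?_⟩
  let G : List (A × A) → List ℕ → (Fin n × Bool → A) := fun σ r =>
    chainMap n (a0, a0) (r.map (fun i => σ.getD i (a0, a0)))
  obtain ⟨W, hW, hWl, z, hz⟩ := hn (fun r σ =>
    if h : IsQuot (chainRel n) ρA (G (σ.1.1 ++ σ.1.2) r) then χ ⟨_, h⟩ else ⟨0, hk⟩)
  have hWlt := hW.lt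
  let w : Fin n × Bool → B := chainMap n (b0, b0) (W.map (fun i => (lB ++ nB).getD i (b0, b0)))
  refine ⟨w, ?_, ?_⟩
  · apply chain_quot ρB hB
    · simpa using hWl
    · intro e he
      obtain ⟨i, hi, rfl⟩ := List.mem_map.1 he
      beta_reduce
      rw [List.getD_eq_getElem _ _ (hWlt i hi)]
      have := List.getElem_mem (hWlt i hi)
      rcases List.mem_append.1 this with h | h
      · rw [(mlB _).1 h]; exact hB.1 _
      · exact ((mnB _).1 h).1
    · intro u v huv
      have : (u, v) ∈ lB ++ nB := by
        by_cases h : u = v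
        · exact List.mem_append_left _ ((mlB _).2 h)
        · exact List.mem_append_right _ ((mnB _).2 ⟨huv, h⟩)
      obtain ⟨i, hi, he⟩ := List.mem_iff_getElem.1 this
      refine List.mem_map.2 ⟨i, hW.surj i (Nat.zero_le _) hi, ?_⟩
      rw [List.getD_eq_getElem _ _ hi, he]
  refine le_trans ?_ hScard
  have hsub : {c : Fin k | ∃ g : {f : Fin n × Bool → A // IsQuot (chainRel n) ρA f},
      (∃ f : B → A, IsQuot ρB ρA f ∧ g.1 = f ∘ w) ∧ χ g = c} ⊆ Set.range z := by
    rintro c ⟨⟨g, hg⟩, ⟨f, hf, hgf⟩, rfl⟩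
    simp only at hgf
    let fs : B × B → A × A := fun e => (f e.1, f e.2)
    obtain ⟨σ1, r1, a1, a2, a3, a4, a5⟩ := normal (a0, a0) (lB.map fs) [] (by simp)
    simp only [List.nil_append, List.length_nil] at a1 a2 a3 a5
    obtain ⟨σ2, r2, b1, b2, b3, b4, b5⟩ := normal (a0, a0) (nB.map fs) σ1 a1
    have hloop : ∀ e, e ∈ σ1 ↔ e.1 = e.2 := by
      intro e
      constructor
      · intro he
        obtain ⟨e', he', rfl⟩ := List.mem_map.1 (a4 he)
        simp only [fs]
        rw [(mlB _).1 he']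
      · intro he
        apply a3
        obtain ⟨b, hb⟩ := hf.1 e.1
        refine List.mem_map.2 ⟨(b, b), (mlB _).2 rfl, ?_⟩
        exact Prod.ext hb (hb.trans he)
    have hnon : ∀ e, e ∈ σ2 ↔ ρA e.1 e.2 ∧ e.1 ≠ e.2 := by
      intro e
      constructor
      · intro he
        refine ⟨?_, fun h => ?_⟩
        · obtain ⟨e', he', rfl⟩ := List.mem_map.1 (b4 he)
          exact hf.2.1 _ _ ((mnB _).1 he').1
        · exact (List.nodup_append.1 b1).2.2 e ((hloop e).2 h) e he rfl
      · rintro ⟨h1, h2⟩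
        obtain ⟨x, y, hxy, hx, hy⟩ := hf.2.2 _ _ h1
        have : e ∈ nB.map fs := by
          refine List.mem_map.2 ⟨(x, y), (mnB _).2 ⟨hxy, ?_⟩, Prod.ext hx hy⟩
          rintro h
          simp only at h
          apply h2
          rw [← hx, ← hy, h]
        rcases List.mem_append.1 (b3 this) with h | h
        · exact absurd ((hloop e).1 h) h2
        · exact h
    have p1 : σ1.Perm lA := (List.perm_ext_iff_of_nodup a1 dlA).2 fun e => by rw [hloop, mlA]
    have p2 : σ2.Perm nA :=
      (List.perm_ext_iff_of_nodup (List.nodup_append.1 b1).2.1 dnA).2 fun e => by rw [hnon, mnA]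
    let σ : S := ⟨(σ1, σ2), by simp [S, p1, p2]⟩
    refine ⟨σ, ?_⟩
    have hr : PW 0 (p+m) (r1 ++ r2) := by
      have := a2.append b2
      rwa [List.length_append, p1.length_eq, p2.length_eq, clA, cnA] at this
    have hmap : (lB ++ nB).map fs = (r1 ++ r2).map (fun i => (σ1 ++ σ2).getD i (a0, a0)) := by
      rw [List.map_append, List.map_append, ← b5, a5]
      congr 1
      apply List.map_congr_left
      intro i hi
      rw [List.getD_append _ _ _ _ (a2.lt i hi)]
    have hrl : (r1 ++ r2).length = (lB ++ nB).length := by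
      have := congrArg List.length hmap
      simpa using this.symm
    have hG : G (σ1 ++ σ2) (wsub (r1 ++ r2) W) = g := by
      rw [hgf]
      have e1 : (wsub (r1 ++ r2) W).map (fun i => (σ1 ++ σ2).getD i (a0, a0)) =
          (W.map (fun i => (lB ++ nB).getD i (b0, b0))).map fs := by
        unfold wsub
        rw [List.map_map, List.map_map]
        apply List.map_congr_left
        intro i hi
        have hi' := hWlt i hi
        simp only [Function.comp]
        rw [← getD_map_lt fs _ (b0, b0) (a0, a0) i hi', hmap,
          getD_map_lt _ _ 0 (a0, a0) i (by omega)]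
      funext x
      simp only [G, w, Function.comp, chainMap]
      rw [e1, getD_map_lt fs _ (b0, b0) (a0, a0) _ (by simp [hWl])]
      split_ifs <;> rfl
    rw [← hz (r1 ++ r2) hr hrl]
    subst hG
    exact dif_pos hg
  refine (Set.ncard_le_ncard hsub (Set.toFinite _)).trans ?_
  rw [← Set.image_univ]
  refine (Set.ncard_image_le (Set.toFinite _)).trans ?_
  rw [Set.ncard_univ]
  simp
end

section
/- Let S denote ω·A₂ with its non-loop edges e_n = ((n, false), (n, true)) linearly ordered by n, and let B be a finite edge-ordered reflexive digraph with n vertices, of which p are isolated. For every k ≥ 1 and every coloring χ : QRMap(S, B) → Fin k each of whose color classes is a Borel subset of the product space V_B^(ℕ×Bool) (V_B the vertex set of B taken discrete, with the product topology), there exists a map w : ℕ × Bool → ℕ × Bool that is a quotient map from ω·A₂ onto itself and whose induced map ŵ maps non-loops to non-loops and is a rigid surjection of the non-loop order onto itself, such that the set {χ(f ∘ w) : f ∈ QRMap(S, B)} has at most 2^(n−p) elements. -/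
/-- A finite edge-ordered reflexive digraph: a finite reflexive digraph `(V, rel)`
together with a tidy linear order `ele` on its edge set (loops precede non-loops). -/
structure EODigraph where
  V : Type
  finite : Finite V
  rel : V → V → Prop
  refl : ∀ x, rel x x
  ele : {p : V × V // rel p.1 p.2} → {p : V × V // rel p.1 p.2} → Prop
  lin : IsLinearOrder {p : V × V // rel p.1 p.2} ele
  tidy : ∀ e e' : {p : V × V // rel p.1 p.2},
    e.1.1 = e.1.2 → e'.1.1 ≠ e'.1.2 → ele e e' ∧ e ≠ e'

/-- The edge set of an edge-ordered reflexive digraph. -/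
def EODigraph.Edge (G : EODigraph) : Type := {p : G.V × G.V // G.rel p.1 p.2}

/-- The strict edge order of an edge-ordered reflexive digraph. -/
def EODigraph.elt (G : EODigraph) (e e' : G.Edge) : Prop := G.ele e e' ∧ e ≠ e'

/-- The reflexive digraph `ω·A₂`: vertex set `ℕ × Bool`, with all loops together
with the non-loop edges `e_n = ((n, false), (n, true))` for every `n`. -/
def omegaA2 : ℕ × Bool → ℕ × Bool → Prop :=
  fun x y => x = y ∨ (x.1 = y.1 ∧ x.2 = false ∧ y.2 = true)

/-- A vertex is isolated if it belongs to no non-loop edge. -/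
def IsIsolated {V : Type*} (ρ : V → V → Prop) (v : V) : Prop :=
  ∀ u, u ≠ v → ¬ρ v u ∧ ¬ρ u v

/-- A quotient rigid map from `S` (`ω·A₂` with its non-loop edges `e_n` ordered by
`n`) to a finite edge-ordered reflexive digraph `B`: a quotient map `f` whose induced
map `n ↦ f̂(e_n)` on the non-loops of `S`, corestricted to its image in the
(tidy-ordered) edge set of `B`, is a rigid surjection. -/
def QRMapTo (B : EODigraph) (f : ℕ × Bool → B.V) : Prop :=
  IsQuot omegaA2 B.rel f ∧
  ∀ d₁ d₂ : B.Edge, B.elt d₁ d₂ →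
    (∃ n : ℕ, (f (n, false), f (n, true)) = d₁.1) →
    (∃ n : ℕ, (f (n, false), f (n, true)) = d₂.1) →
    sInf {n : ℕ | (f (n, false), f (n, true)) = d₁.1} <
      sInf {n : ℕ | (f (n, false), f (n, true)) = d₂.1}

namespace CS

/-- Restricted growth: every value is preceded by all smaller values. -/
def RG (f : ℕ → ℕ) : Prop := ∀ i b, b < f i → ∃ j < i, f j = b

/-- Rigid surjections of `ℕ` fixing the first `a` numbers. -/
def WW (a : ℕ) (g : ℕ → ℕ) : Prop := RG g ∧ Function.Surjective g ∧ ∀ i < a, g i = i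

/-- Rigid surjections of `ℕ` onto `{0, …, m-1}` fixing the first `a` numbers. -/
def RR (a m : ℕ) (f : ℕ → ℕ) : Prop :=
  RG f ∧ (∀ i, f i < m) ∧ (∀ b < m, ∃ i, f i = b) ∧ ∀ i < a, f i = i

lemma RG.le {f : ℕ → ℕ} (h : RG f) : ∀ i, f i ≤ i := by
  intro i
  induction i using Nat.strong_induction_on with
  | _ i ih =>
    by_contra hc
    obtain ⟨j, hj, e⟩ := h i (f i - 1) (by omega)
    have := ih j hj
    omega

lemma RG.comp {f g : ℕ → ℕ} (hf : RG f) (hg : RG g) : RG (f ∘ g) := by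
  intro i b hb
  obtain ⟨l, hl, rfl⟩ := hf _ _ hb
  obtain ⟨j, hj, rfl⟩ := hg _ _ hl
  exact ⟨j, hj, rfl⟩

lemma WW.comp {a : ℕ} {f g : ℕ → ℕ} (hf : WW a f) (hg : WW a g) : WW a (f ∘ g) :=
  ⟨hf.1.comp hg.1, hf.2.1.comp hg.2.1, fun i hi => by simp [hg.2.2 i hi, hf.2.2 i hi]⟩

lemma WW.mono {a b : ℕ} {g : ℕ → ℕ} (h : b ≤ a) (hg : WW a g) : WW b g :=
  ⟨hg.1, hg.2.1, fun i hi => hg.2.2 i (by omega)⟩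

lemma WW.id (a : ℕ) : WW a id :=
  ⟨fun _ b hb => ⟨b, hb, rfl⟩, Function.surjective_id, fun _ _ => rfl⟩

lemma RR.comp {a m : ℕ} {f g : ℕ → ℕ} (hf : RR a m f) (hg : WW a g) : RR a m (f ∘ g) := by
  refine ⟨hf.1.comp hg.1, fun i => hf.2.1 _, fun b hb => ?_, fun i hi => by
    simp [hg.2.2 i hi, hf.2.2.2 i hi]⟩
  obtain ⟨i, rfl⟩ := hf.2.2.1 b hb
  obtain ⟨j, rfl⟩ := hg.2.1 i
  exact ⟨j, rfl⟩

lemma RG.of_comp {f g : ℕ → ℕ} (hfg : RG (f ∘ g)) (hg : RG g) (hs : Function.Surjective g) :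
    RG f := by
  classical
  intro l b hb
  have hex := hs l
  have hi := Nat.find_spec hex
  have hmin : ∀ j < Nat.find hex, g j ≠ l := fun j hj => Nat.find_min hex hj
  set i := Nat.find hex
  obtain ⟨j, hj, e⟩ := hfg i b (by simpa [hi] using hb)
  refine ⟨g j, ?_, e⟩
  rcases lt_trichotomy (g j) l with h | h | h
  · exact h
  · exact absurd h (hmin j hj)
  · obtain ⟨j', hj', e'⟩ := hg _ _ h
    exact absurd e' (hmin j' (by omega))

lemma fusion (a : ℕ) (Q : ℕ → (ℕ → ℕ) → Prop) (G0 : ℕ → ℕ) (h0 : WW a G0) (hQ0 : Q 0 G0)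
    (step : ∀ n G, WW a G → Q n G → ∃ v, WW (a + n + 1) v ∧ Q (n + 1) (v ∘ G)) :
    ∃ G, WW a G ∧ ∀ n, ∃ G' v, WW a G' ∧ Q n G' ∧ WW (a + n + 1) v ∧ G = v ∘ G' := by
  classical
  choose! v hv1 hv2 using step
  let G : ℕ → ℕ → ℕ := fun n => Nat.rec G0 (fun n g => v n g ∘ g) n
  have hG1 : ∀ n, G (n + 1) = v n (G n) ∘ G n := fun n => rfl
  have hG : ∀ n, WW a (G n) ∧ Q n (G n) := by
    intro n
    induction n with
    | zero => exact ⟨h0, hQ0⟩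
    | succ n ih =>
      rw [hG1]
      exact ⟨((hv1 n _ ih.1 ih.2).mono (by omega)).comp ih.1, hv2 n _ ih.1 ih.2⟩
  have hv : ∀ n, WW (a + n + 1) (v n (G n)) := fun n => hv1 n _ (hG n).1 (hG n).2
  -- stability
  have stab : ∀ n i, G n i < a + n + 1 → ∀ m, n ≤ m → G m i = G n i := by
    intro n i hi m hm
    induction m, hm using Nat.le_induction with
    | base => rfl
    | succ m hm ih =>
      rw [hG1, Function.comp_apply, ih]
      exact (hv m).2.2 _ (by omega)
  have stab' : ∀ i m, i ≤ m → G m i = G i i := fun i m hm =>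
    stab i i (by have := (hG i).1.1.le i; omega) m hm
  have cong : ∀ n i i', G n i = G n i' → ∀ m, n ≤ m → G m i = G m i' := by
    intro n i i' h m hm
    induction m, hm using Nat.le_induction with
    | base => exact h
    | succ m hm ih => rw [hG1, Function.comp_apply, Function.comp_apply, ih]
  let L : ℕ → ℕ := fun i => G i i
  have hLlow : ∀ n i, G n i < a + n + 1 → L i = G n i := by
    intro n i h
    rw [← stab n i h (max n i) (le_max_left _ _), stab' i _ (le_max_right _ _)]
  have hLRG : RG L := by
    intro i b hb
    obtain ⟨j, hj, e⟩ := (hG i).1.1 i b hb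
    exact ⟨j, hj, by rw [← e, stab' j i hj.le]⟩
  have hLs : Function.Surjective L := by
    intro b
    obtain ⟨i, hi⟩ := (hG b).1.2.1 b
    exact ⟨i, by rw [hLlow b i (by omega), hi]⟩
  refine ⟨L, ⟨hLRG, hLs, fun i hi => ?_⟩, fun n => ?_⟩
  · have := (hG i).1.2.2 i hi
    exact this
  · have hs := (hG n).1.2.1
    choose pre hpre using hs
    have hfac : L = (L ∘ pre) ∘ G n := by
      funext i
      have h1 := cong n i (pre (G n i)) (hpre _).symm (max n (max i (pre (G n i)))) (by omega)
      rw [stab' i _ (by omega), stab' (pre (G n i)) _ (by omega)] at h1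
      exact h1
    refine ⟨G n, L ∘ pre, (hG n).1, (hG n).2, ⟨?_, ?_, ?_⟩, hfac⟩
    · exact RG.of_comp (hfac ▸ hLRG) (hG n).1.1 (hG n).1.2.1
    · intro b
      obtain ⟨i, hi⟩ := hLs b
      refine ⟨G n i, ?_⟩
      rw [← hi]
      exact (congrFun hfac i).symm
    · intro l hl
      rw [Function.comp_apply, hLlow n (pre l) (by rw [hpre]; exact hl), hpre]

/-- Construction of an infinite variable word from one-step extensions. -/
lemma tree (a : ℕ) (Good : ℕ → List (Fin a) → Prop) (h0 : ∃ w, Good 0 w)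
    (hs : ∀ n (F : Finset (List (Fin a))), (∀ w ∈ F, Good n w) →
      ∃ r : List (Option (Fin a)), ∀ w ∈ F, ∀ b,
        Good (n + 1) (w ++ b :: r.map (fun o => o.getD b))) :
    ∃ G, WW a G ∧ ∀ n, ∃ q, G (a + q) = a + n ∧ (∀ i < q, G (a + i) < a + n) ∧
      ∀ s : ℕ → Fin a, (∀ i : Fin a, s i = i) →
        Good n ((List.range q).map fun i => s (G (a + i))) := by
  classical
  let Q : ℕ → (ℕ → ℕ) → Prop := fun n G => ∃ q, (∀ j, G (a + q + j) = a + n + j) ∧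
    (∀ i < q, G (a + i) < a + n) ∧
      ∀ s : ℕ → Fin a, (∀ i : Fin a, s i = i) →
        Good n ((List.range q).map fun i => s (G (a + i)))
  -- inserting a word after position `c`
  have ins : ∀ (c : ℕ) (r : List ℕ), (∀ x ∈ r, x < c) →
      ∃ v, WW c v ∧ (∀ i (h : i < r.length), v (c + i) = r[i]) ∧
        ∀ j, v (c + r.length + j) = c + j := by
    intro c r hr
    let v : ℕ → ℕ := fun i => if i < c then i else
      if h : i - c < r.length then r[i - c] else i - r.length
    have v1 : ∀ i < c, v i = i := fun i hi => by simp [v, hi]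
    have v2 : ∀ i (h : i < r.length), v (c + i) = r[i] := fun i hi => by simp [v, hi]
    have v3 : ∀ j, v (c + r.length + j) = c + j := fun j => by
      have h1 : ¬ (c + r.length + j < c) := by omega
      have h2 : ¬ (c + r.length + j - c < r.length) := by omega
      simp only [v, h1, h2, if_false, dif_neg, not_false_eq_true]; omega
    refine ⟨v, ⟨?_, ?_, v1⟩, v2, v3⟩
    · intro i b hb
      by_cases hi : i < c
      · rw [v1 i hi] at hb; exact ⟨b, hb, v1 b (by omega)⟩
      by_cases hi2 : i - c < r.length
      · have : v i = r[i - c] := by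
          have := v2 _ hi2
          rwa [show c + (i - c) = i by omega] at this
        have h3 := hr _ (List.getElem_mem hi2)
        exact ⟨b, by omega, v1 b (by omega)⟩
      · have := v3 (i - c - r.length)
        rw [show c + r.length + (i - c - r.length) = i by omega] at this
        by_cases hbc : b < c
        · exact ⟨b, by omega, v1 b hbc⟩
        · exact ⟨c + r.length + (b - c), by omega, by rw [v3]; omega⟩
    · intro b
      by_cases hbc : b < c
      · exact ⟨b, v1 b hbc⟩
      · exact ⟨c + r.length + (b - c), by rw [v3]; omega⟩
  have start : ∃ G0, WW a G0 ∧ Q 0 G0 := by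
    obtain ⟨w, hw⟩ := h0
    obtain ⟨v, hv, h1, h2⟩ := ins a (w.map Fin.val) (by simp)
    simp only [List.length_map, List.getElem_map] at h1 h2
    refine ⟨v, hv, w.length, fun j => by rw [h2]; omega, fun i hi => by rw [h1 i hi]; omega, ?_⟩
    intro s hs'
    convert hw
    apply List.ext_getElem
    · simp
    · intro i h3 h4
      simp only [List.getElem_map, List.getElem_range]
      rw [h1 i h4, hs']
  obtain ⟨G0, hG0, hQ0⟩ := start
  have := fusion a Q G0 hG0 hQ0 (by
    rintro n G hG ⟨q, hq1, hq2, hq3⟩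
    let wd : (ℕ → Fin a) → List (Fin a) := fun s => (List.range q).map fun i => s (G (a + i))
    have hfin : {w : List (Fin a) | w.length = q ∧ Good n w}.Finite :=
      (List.finite_length_eq (Fin a) q).subset fun w hw => hw.1
    obtain ⟨r, hr⟩ := hs n hfin.toFinset (by simp)
    obtain ⟨v, hv, h1, h2⟩ := ins (a + n + 1)
      (r.map (fun o => (o.map Fin.val).getD (a + n))) (by
        intro x hx
        obtain ⟨o, -, rfl⟩ := List.mem_map.1 hx
        cases o with
        | none => simp
        | some b => simp; omega)
    simp only [List.length_map, List.getElem_map] at h1 h2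
    have e0 : ∀ i < q, v (G (a + i)) = G (a + i) := fun i hi =>
      hv.2.2 _ (by have := hq2 i hi; omega)
    have e1 : v (G (a + q)) = a + n := by
      have := hq1 0
      simp only [add_zero] at this
      rw [this]; exact hv.2.2 _ (by omega)
    have e2 : ∀ j, G (a + (q + 1 + j)) = a + n + 1 + j := fun j => by
      have := hq1 (1 + j)
      rw [show a + (q + 1 + j) = a + q + (1 + j) by omega, this]; omega
    have e3 : ∀ j (h : j < r.length), v (G (a + (q + 1 + j))) =
        (r[j].map Fin.val).getD (a + n) := fun j hj => by rw [e2, h1 j hj]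
    refine ⟨v, hv, q + 1 + r.length, ?_, ?_, ?_⟩
    · intro j
      rw [Function.comp_apply, show a + (q + 1 + r.length) + j = a + (q + 1 + (r.length + j)) by omega,
        e2, ← add_assoc, h2]; omega
    · intro i hi
      rw [Function.comp_apply]
      rcases lt_trichotomy i q with h | h | h
      · rw [e0 i h]; have := hq2 i h; omega
      · rw [h, e1]; omega
      · obtain ⟨j, rfl⟩ : ∃ j, i = q + 1 + j := ⟨i - q - 1, by omega⟩
        rw [e3 j (by omega)]
        cases r[j]'(by omega) with
        | none => simp
        | some b => simp; omega
    · intro s hs'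
      have := hr (wd s) (by
        simp only [Set.Finite.mem_toFinset, Set.mem_ofPred_eq]
        exact ⟨by simp [wd], hq3 s hs'⟩) (s (a + n))
      convert this
      apply List.ext_getElem
      · simp [wd]; omega
      · intro i h3 h4
        simp only [List.getElem_map, List.getElem_range, Function.comp_apply]
        rcases lt_trichotomy i q with h | h | h
        · rw [List.getElem_append_left (by simpa [wd] using h)]
          simp [wd, e0 i h]
        · subst h
          rw [List.getElem_append_right (by simp [wd])]
          simp [wd, e1]
        · obtain ⟨j, rfl⟩ : ∃ j, i = q + 1 + j := ⟨i - q - 1, by omega⟩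
          have hj : j < r.length := by simp at h3; omega
          rw [List.getElem_append_right (by simp [wd]; omega), e3 j hj]
          have hl : q + 1 + j - (wd s).length = j + 1 := by simp [wd]; omega
          simp only [hl, List.getElem_cons_succ, List.getElem_map]
          cases r[j] with
          | none => simp
          | some b => simp [hs'])
  obtain ⟨G, hG, hn⟩ := this
  refine ⟨G, hG, fun n => ?_⟩
  obtain ⟨G', v, hG', ⟨q, hq1, hq2, hq3⟩, hv, rfl⟩ := hn n
  have e0 : ∀ i < q, v (G' (a + i)) = G' (a + i) := fun i hi =>
      hv.2.2 _ (by have := hq2 i hi; omega)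
  refine ⟨q, ?_, fun i hi => ?_, fun s hs' => ?_⟩
  · have := hq1 0
    simp only [add_zero] at this
    rw [Function.comp_apply, this]; exact hv.2.2 _ (by omega)
  · rw [Function.comp_apply, e0 i hi]; exact hq2 i hi
  · convert hq3 s hs' using 1
    apply List.map_congr_left
    intro i hi
    rw [Function.comp_apply, e0 i (by simpa using hi)]

section ultra

attribute [local instance] Ultrafilter.semigroup

open Filter

lemma exists_min_left_ideal (M : Type) [Semigroup M] [Nonempty M] :
    ∃ L : Set (Ultrafilter M), IsClosed L ∧ L.Nonempty ∧ (∀ p, ∀ q ∈ L, p * q ∈ L) ∧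
      ∀ p ∈ L, ∀ q ∈ L, q * q = q → p * q = p := by
  let S : Set (Set (Ultrafilter M)) :=
    {L | IsClosed L ∧ L.Nonempty ∧ ∀ p, ∀ q ∈ L, p * q ∈ L}
  obtain ⟨L, hL⟩ : ∃ L, Minimal (· ∈ S) L := by
    refine zorn_superset S fun c hcs hc => ?_
    refine ⟨⋂₀ c, ⟨isClosed_sInter fun t ht => (hcs ht).1, ?_, fun p q hq => ?_⟩,
      fun s hs => Set.sInter_subset_of_mem hs⟩
    · obtain rfl | hcnemp := c.eq_empty_or_nonempty
      · rw [Set.sInter_empty]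
        obtain ⟨m⟩ := ‹Nonempty M›
        exact ⟨pure m, trivial⟩
      convert
        @IsCompact.nonempty_iInter_of_directed_nonempty_isCompact_isClosed _ _ _
          hcnemp.coe_sort (fun x : c => x.1) ?_ ?_ ?_ ?_
      · exact Set.sInter_eq_iInter
      · exact DirectedOn.directed_val (IsChain.directedOn hc.symm)
      exacts [fun i => (hcs i.prop).2.1, fun i => (hcs i.prop).1.isCompact,
        fun i => (hcs i.prop).1]
    · rw [Set.mem_sInter] at hq ⊢
      exact fun t ht => (hcs ht).2.2 p q (hq t ht)
  obtain ⟨h1, h2, h3⟩ := hL.prop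
  refine ⟨L, h1, h2, h3, fun p hp q hq hqq => ?_⟩
  have hs : (· * q) '' L ∈ S := by
    refine ⟨(h1.isCompact.image (Ultrafilter.continuous_mul_left q)).isClosed, h2.image _, ?_⟩
    rintro r _ ⟨t, ht, rfl⟩
    exact ⟨r * t, h3 r t ht, mul_assoc r t q⟩
  have hsub : (· * q) '' L ⊆ L := by
    rintro _ ⟨t, ht, rfl⟩
    exact h3 t q hq
  obtain ⟨r, hr, e⟩ := hL.le_of_le hs hsub hp
  simp only at e
  rw [← e, mul_assoc, hqq]

lemma ultra_map_mul {M N : Type} [Semigroup M] [Semigroup N] (φ : M → N)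
    (hφ : ∀ x y, φ (x * y) = φ x * φ y) (U V : Ultrafilter M) :
    (U * V).map φ = U.map φ * V.map φ := by
  apply Ultrafilter.coe_inj.mp
  refine Filter.ext' fun p => ?_
  rw [Ultrafilter.eventually_mul]
  simp only [Ultrafilter.coe_map, eventually_map]
  rw [Ultrafilter.eventually_mul]
  simp only [hφ]

lemma ultra_map_continuous {M N : Type} (φ : M → N) :
    Continuous (fun U : Ultrafilter M => U.map φ) :=
  ultrafilterBasis_is_basis.continuous_iff.2 <| Set.forall_mem_range.mpr fun s =>
    ultrafilter_isOpen_basic (φ ⁻¹' s)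

/-- Substitution of the letter `b` for the variable. -/
def subst {A : Type} (b : A) : FreeMonoid (Option A) →* FreeMonoid A :=
  FreeMonoid.map (fun o => o.getD b)

lemma exists_var_ultra (A : Type) : ∃ v : Ultrafilter (FreeMonoid (Option A)),
    (∀ᶠ x in (v : Filter (FreeMonoid (Option A))), ∃ r, x = FreeMonoid.of none * r) ∧
    ∀ a b : A, v.map (subst a) * v.map (subst b) = v.map (subst a) := by
  obtain ⟨L, h1, ⟨q, hq⟩, h3, h4⟩ := exists_min_left_ideal (FreeMonoid A)
  let X : Set (Ultrafilter (FreeMonoid (Option A))) :=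
    {t | {x | ∃ r, x = FreeMonoid.of none * r} ∈ t} ∩ ⋂ a : A, (fun t => t.map (subst a)) ⁻¹' L
  have hXc : IsClosed X := (ultrafilter_isClosed_basic _).inter
    (isClosed_iInter fun a => h1.preimage (ultra_map_continuous _))
  have hXm : ∀ᵉ (x ∈ X) (y ∈ X), x * y ∈ X := by
    rintro x ⟨hx, -⟩ y ⟨-, hy⟩
    refine ⟨?_, ?_⟩
    · change ∀ᶠ m in ((x * y : Ultrafilter (FreeMonoid (Option A))) :
        Filter (FreeMonoid (Option A))), ∃ r, m = FreeMonoid.of none * r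
      rw [Ultrafilter.eventually_mul]
      filter_upwards [hx] with m hm
      obtain ⟨r, rfl⟩ := hm
      exact Eventually.of_forall fun m' => ⟨r * m', mul_assoc _ _ _⟩
    · simp only [Set.mem_iInter, Set.mem_preimage] at hy ⊢
      intro a
      rw [ultra_map_mul _ (map_mul _)]
      exact h3 _ _ (hy a)
  have hXn : X.Nonempty := by
    refine ⟨pure (FreeMonoid.of none) * q.map (FreeMonoid.map some), ?_, ?_⟩
    · change ∀ᶠ m in ((pure (FreeMonoid.of none) * q.map (FreeMonoid.map some) :
        Ultrafilter (FreeMonoid (Option A))) : Filter (FreeMonoid (Option A))),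
        ∃ r, m = FreeMonoid.of none * r
      rw [Ultrafilter.eventually_mul]
      rw [Ultrafilter.coe_pure, eventually_pure]
      exact Eventually.of_forall fun m' => ⟨m', rfl⟩
    · simp only [Set.mem_iInter, Set.mem_preimage]
      intro a
      rw [ultra_map_mul _ (map_mul _), Ultrafilter.map_map]
      have : (subst a : FreeMonoid (Option A) → FreeMonoid A) ∘ (FreeMonoid.map some) = id := by
        funext x
        simp only [subst, Function.comp_apply, FreeMonoid.map_map, id]
        exact List.map_id x
      rw [this, Ultrafilter.map_id]
      exact h3 _ _ hq
  obtain ⟨v, ⟨hv1, hv2⟩, hvv⟩ := exists_idempotent_in_compact_subsemigroup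
    Ultrafilter.continuous_mul_left X hXn hXc.isCompact hXm
  simp only [Set.mem_iInter, Set.mem_preimage] at hv2
  refine ⟨v, hv1, fun a b => h4 _ (hv2 a) _ (hv2 b) ?_⟩
  rw [← ultra_map_mul _ (map_mul _), hvv]

/-- The Carlson–Simpson lemma. -/
lemma cs_lemma (a : ℕ) (ha : 0 < a) {k : ℕ} (c : List (Fin a) → Fin k) :
    ∃ G, WW a G ∧ ∃ col, ∀ n, ∃ q, G (a + q) = a + n ∧ (∀ i < q, G (a + i) < a + n) ∧
      ∀ s : ℕ → Fin a, (∀ i : Fin a, s i = i) →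
        c ((List.range q).map fun i => s (G (a + i))) = col := by
  classical
  obtain ⟨v, hv, hvm⟩ := exists_var_ultra (Fin a)
  let U : Ultrafilter (FreeMonoid (Fin a)) := v.map (subst ⟨0, ha⟩)
  have hU : ∀ b, U * v.map (subst b) = U := fun b => hvm _ b
  obtain ⟨col, hcol⟩ : ∃ col, ∀ᶠ w in (U : Filter _), c (FreeMonoid.toList w) = col := by
    have := Ultrafilter.eventually_exists_iff (f := U)
      (P := fun (col : Fin k) w => c (FreeMonoid.toList w) = col)
    exact this.1 (Eventually.of_forall fun w => ⟨_, rfl⟩)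
  let C : FreeMonoid (Fin a) → Prop := fun w => c (FreeMonoid.toList w) = col
  let Gd : FreeMonoid (Fin a) → Prop := fun w => C w ∧ ∀ b, ∀ᶠ x in v, C (w * subst b x)
  have hGd : ∀ᶠ w in (U : Filter _), Gd w := by
    refine hcol.and (eventually_all.2 fun b => ?_)
    have h := hcol
    rw [← hU b, Ultrafilter.eventually_mul] at h
    simpa only [Ultrafilter.coe_map, eventually_map] using h
  have hstep : ∀ w, Gd w → ∀ b, ∀ᶠ x in v, Gd (w * subst b x) := by
    intro w hw b
    refine (hw.2 b).and (eventually_all.2 fun b' => ?_)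
    have h : ∀ᶠ y in ((v.map (subst b) : Ultrafilter _) : Filter _), C (w * y) := by
      simpa only [Ultrafilter.coe_map, eventually_map] using hw.2 b
    rw [← hvm b b', Ultrafilter.eventually_mul] at h
    simpa only [Ultrafilter.coe_map, eventually_map, ← mul_assoc] using h
  obtain ⟨G, hG, h⟩ := tree a (fun _ w => Gd (FreeMonoid.ofList w)) (hGd.exists) (by
    intro n F hF
    have : ∀ᶠ x in v, ∀ w ∈ F, ∀ b, Gd (FreeMonoid.ofList w * subst b x) := by
      rw [eventually_all_finset]
      intro w hw
      exact eventually_all.2 (hstep _ (hF w hw))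
    obtain ⟨x, hx, r, rfl⟩ := (this.and hv).exists
    refine ⟨FreeMonoid.toList r, fun w hw b => ?_⟩
    exact hx w hw b)
  refine ⟨G, hG, col, fun n => ?_⟩
  obtain ⟨q, h1, h2, h3⟩ := h n
  exact ⟨q, h1, h2, fun s hs => (h3 s hs).1⟩

end ultra

section main

/-- Replace the letters at positions `a, …, a + |u| - 1` by the word `u`, shifting the rest. -/
def sig (a : ℕ) (u : List (Fin a)) : ℕ → ℕ := fun i =>
  if i < a then i else if h : i - a < u.length then (u[i - a] : ℕ) else i - u.length

lemma sig_lt {a : ℕ} (u : List (Fin a)) {i : ℕ} (h : i < a) : sig a u i = i := by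
  simp [sig, h]

lemma sig_mid {a : ℕ} (u : List (Fin a)) {i : ℕ} (h : i < u.length) :
    sig a u (a + i) = (u[i] : ℕ) := by
  simp [sig, h]

lemma sig_ge {a : ℕ} (u : List (Fin a)) (j : ℕ) :
    sig a u (a + u.length + j) = a + j := by
  have h1 : ¬ (a + u.length + j < a) := by omega
  have h2 : ¬ (a + u.length + j - a < u.length) := by omega
  simp only [sig, h1, h2, if_false, dif_neg, not_false_eq_true]; omega

lemma cases3 (a l i : ℕ) : i < a ∨ (∃ j < l, i = a + j) ∨ ∃ j, i = a + l + j := by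
  by_cases h : i < a
  · exact Or.inl h
  by_cases h2 : i - a < l
  · exact Or.inr (Or.inl ⟨i - a, h2, by omega⟩)
  · exact Or.inr (Or.inr ⟨i - a - l, by omega⟩)

lemma sig_WW {a : ℕ} (u : List (Fin a)) : WW a (sig a u) := by
  refine ⟨?_, ?_, fun i hi => sig_lt u hi⟩
  · intro i b hb
    rcases cases3 a u.length i with h | ⟨j, hj, rfl⟩ | ⟨j, rfl⟩
    · rw [sig_lt u h] at hb; exact ⟨b, hb, sig_lt u (by omega)⟩
    · rw [sig_mid u hj] at hb; exact ⟨b, by omega, sig_lt u (by omega)⟩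
    · rw [sig_ge] at hb
      by_cases hba : b < a
      · exact ⟨b, by omega, sig_lt u hba⟩
      · exact ⟨a + u.length + (b - a), by omega, by rw [sig_ge]; omega⟩
  · intro b
    by_cases hba : b < a
    · exact ⟨b, sig_lt u hba⟩
    · exact ⟨a + u.length + (b - a), by rw [sig_ge]; omega⟩

lemma factor {a m : ℕ} (u : List (Fin a)) {g : ℕ → ℕ} (hg : RR a m g)
    (h1 : ∀ i (h : i < u.length), g (a + i) = u[i]) (h2 : g (a + u.length) = a) :
    ∃ h, RR (a + 1) m h ∧ g = h ∘ sig a u := by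
  obtain ⟨hRG, hlt, hsu, hfix⟩ := hg
  let h : ℕ → ℕ := fun i => if i < a then i else g (i + u.length)
  have k1 : ∀ i < a, h i = i := fun i hi => by simp [h, hi]
  have k2 : ∀ j, h (a + j) = g (a + u.length + j) := fun j => by
    have : ¬ (a + j < a) := by omega
    simp only [h, this, if_false]; congr 1; omega
  have am : a < m := by rw [← h2]; exact hlt _
  have lift : ∀ j b, a ≤ b → g j = b → ∃ j', j = a + u.length + j' := by
    intro j b hb e
    rcases cases3 a u.length j with h | ⟨j, hj, rfl⟩ | h
    · have := hfix j h; omega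
    · have := h1 j hj; omega
    · exact h
  refine ⟨h, ⟨?_, ?_, ?_, ?_⟩, ?_⟩
  · intro i b hb
    by_cases hi : i < a
    · rw [k1 i hi] at hb; exact ⟨b, hb, k1 b (by omega)⟩
    obtain ⟨j, rfl⟩ : ∃ j, i = a + j := ⟨i - a, by omega⟩
    by_cases hba : b < a
    · exact ⟨b, by omega, k1 b hba⟩
    rw [k2] at hb
    obtain ⟨l, hl, e⟩ := hRG _ _ hb
    obtain ⟨j', rfl⟩ := lift l b (by omega) e
    exact ⟨a + j', by omega, by rw [k2, e]⟩
  · intro i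
    by_cases hi : i < a
    · rw [k1 i hi]; omega
    · simp only [h, hi, if_false]; exact hlt _
  · intro b hb
    by_cases hba : b < a
    · exact ⟨b, k1 b hba⟩
    obtain ⟨l, e⟩ := hsu b hb
    obtain ⟨j', rfl⟩ := lift l b (by omega) e
    exact ⟨a + j', by rw [k2, e]⟩
  · intro i hi
    rcases Nat.lt_succ_iff_lt_or_eq.1 hi with h | h
    · exact k1 i h
    · have := k2 0
      simp only [add_zero] at this
      rw [h, this, h2]
  · funext i
    rw [Function.comp_apply]
    rcases cases3 a u.length i with h | ⟨j, hj, rfl⟩ | ⟨j, rfl⟩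
    · rw [sig_lt u h, k1 i h, hfix i h]
    · rw [sig_mid u hj, k1 _ (Fin.is_lt _), h1 j hj]
    · rw [sig_ge, k2]

lemma lift_map {a : ℕ} (u : List (Fin a)) {w : ℕ → ℕ} (hw : WW (a + 1) w) :
    ∃ v, WW (a + u.length + 1) v ∧ sig a u ∘ v = w ∘ sig a u := by
  obtain ⟨hRG, hsu, hfix⟩ := hw
  set n := u.length with hn
  let v : ℕ → ℕ := fun i => if i < a + n + 1 then i else
    if w (i - n) < a then w (i - n) else w (i - n) + n
  have v1 : ∀ i < a + n + 1, v i = i := fun i hi => if_pos hi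
  have v2 : ∀ j, v (a + n + 1 + j) =
      if w (a + 1 + j) < a then w (a + 1 + j) else w (a + 1 + j) + n := fun j => by
    have h1 : ¬ (a + n + 1 + j < a + n + 1) := by omega
    have h2 : a + n + 1 + j - n = a + 1 + j := by omega
    simp only [v, h1, if_false, h2]
  have key : ∀ j b, a + n + 1 ≤ b → w j = b - n → ∃ l, j = a + 1 + l ∧ v (a + n + 1 + l) = b := by
    intro j b hb e
    have hj : a + 1 ≤ j := by
      by_contra hc
      have := hfix j (by omega)
      omega
    refine ⟨j - (a + 1), by omega, ?_⟩
    rw [v2, show a + 1 + (j - (a + 1)) = j by omega, e, if_neg (by omega)]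
    omega
  refine ⟨v, ⟨?_, ?_, v1⟩, ?_⟩
  · intro i b hb
    by_cases hi : i < a + n + 1
    · rw [v1 i hi] at hb; exact ⟨b, hb, v1 b (by omega)⟩
    by_cases hb2 : b < a + n + 1
    · exact ⟨b, by omega, v1 b hb2⟩
    obtain ⟨j, rfl⟩ : ∃ j, i = a + n + 1 + j := ⟨i - (a + n + 1), by omega⟩
    rw [v2] at hb
    split_ifs at hb with h
    · omega
    obtain ⟨l, hl, e⟩ := hRG (a + 1 + j) (b - n) (by omega)
    obtain ⟨l', rfl, e'⟩ := key l b (by omega) e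
    exact ⟨_, by omega, e'⟩
  · intro b
    by_cases hb2 : b < a + n + 1
    · exact ⟨b, v1 b hb2⟩
    obtain ⟨l, e⟩ := hsu (b - n)
    obtain ⟨l', rfl, e'⟩ := key l b (by omega) e
    exact ⟨_, e'⟩
  · funext i
    simp only [Function.comp_apply]
    rcases cases3 a u.length i with h | ⟨j, hj, rfl⟩ | ⟨j, rfl⟩
    · rw [v1 i (by omega), sig_lt u h, hfix i (by omega)]
    · rw [v1 _ (by omega), sig_mid u hj, hfix _ (by omega)]
    · rw [sig_ge]
      rcases j with _ | j
      · rw [v1 _ (by omega), sig_ge, hfix _ (by omega)]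
      · rw [← hn, show a + n + (j + 1) = a + n + 1 + j by omega, v2,
          show a + (j + 1) = a + 1 + j by omega]
        split_ifs with h
        · exact sig_lt u h
        · have := sig_ge u (w (a + 1 + j) - a)
          rw [show a + u.length + (w (a + 1 + j) - a) = w (a + 1 + j) + n by omega] at this
          rw [this]; omega

/-- Preservation of stabilised words under composition. -/
lemma pres {a m k : ℕ} {c : (ℕ → ℕ) → Fin k} (u : List (Fin a)) {G v : ℕ → ℕ} {col : Fin k}
    (hc : ∀ h, RR (a + 1) m h → c (h ∘ sig a u ∘ G) = col) (hv : WW (a + u.length + 1) v) :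
    ∀ h, RR (a + 1) m h → c (h ∘ sig a u ∘ v ∘ G) = col := by
  intro h hh
  have hh' : RR a m h := ⟨hh.1, hh.2.1, hh.2.2.1, fun i hi => hh.2.2.2 i (by omega)⟩
  have hg : RR a m (h ∘ sig a u ∘ v) :=
    hh'.comp ((sig_WW u).comp (hv.mono (by omega)))
  obtain ⟨h', hR, e⟩ := factor u hg (by
    intro i hi
    simp only [Function.comp_apply]
    rw [hv.2.2 _ (by omega), sig_mid u hi, hh.2.2.2 _ (by omega)]) (by
    simp only [Function.comp_apply]
    have := sig_ge u 0
    simp only [add_zero] at this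
    rw [hv.2.2 _ (by omega), this, hh.2.2.2 _ (by omega)])
  rw [← hc h' hR]
  congr 1
  have : h ∘ sig a u ∘ v ∘ G = (h ∘ sig a u ∘ v) ∘ G := rfl
  rw [this, e]; rfl

lemma comp_meas (G : ℕ → ℕ) : Measurable (fun h : ℕ → ℕ => h ∘ G) :=
  measurable_pi_lambda _ fun i => measurable_pi_apply (G i)

/-- The Ramsey property for `RR a m`. -/
def Ram (a m : ℕ) : Prop := ∀ (k : ℕ) (c : (ℕ → ℕ) → Fin k), Measurable c →
    ∃ G, WW a G ∧ ∃ col : Fin k, ∀ h, RR a m h → c (h ∘ G) = col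

lemma ram_step (a m : ℕ) (ha : 0 < a) (ham : a < m) (ih : Ram (a + 1) m) : Ram a m := by
  classical
  intro k c hc
  let Q : ℕ → (ℕ → ℕ) → Prop := fun n G => ∀ u : List (Fin a), u.length < n →
    ∃ col, ∀ h, RR (a + 1) m h → c (h ∘ sig a u ∘ G) = col
  obtain ⟨G, hG, hn⟩ := fusion a Q id (WW.id a) (fun u hu => absurd hu (by omega)) (by
    intro n G hG hQ
    have claim : ∀ F : Finset (List (Fin a)), (∀ u ∈ F, u.length = n) →
        ∃ v, WW (a + n + 1) v ∧ ∀ u ∈ F, ∃ col, ∀ h, RR (a + 1) m h →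
          c (h ∘ sig a u ∘ v ∘ G) = col := by
      intro F
      induction F using Finset.induction_on with
      | empty => exact fun _ => ⟨id, WW.id _, by simp⟩
      | insert u F hu ihF =>
        intro hF
        obtain ⟨v, hv, hvF⟩ := ihF fun u hu => hF u (Finset.mem_insert_of_mem hu)
        have hun := hF u (Finset.mem_insert_self _ _)
        obtain ⟨w, hw, col, hcol⟩ := ih k (fun h => c (h ∘ (sig a u ∘ v ∘ G)))
          (hc.comp (comp_meas _))
        obtain ⟨l, hl, e⟩ := lift_map u hw
        rw [hun] at hl
        refine ⟨l ∘ v, hl.comp hv, fun u' hu' => ?_⟩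
        rcases Finset.mem_insert.1 hu' with rfl | hu'
        · refine ⟨col, fun h hh => ?_⟩
          rw [← hcol h hh]
          congr 1
          have : h ∘ sig a u' ∘ (l ∘ v) ∘ G = h ∘ (sig a u' ∘ l) ∘ v ∘ G := rfl
          rw [this, e]; rfl
        · obtain ⟨col', hcol'⟩ := hvF u' hu'
          have hlen := hF u' (Finset.mem_insert_of_mem hu')
          exact ⟨col', pres (G := v ∘ G) u' hcol' (by rw [hlen]; exact hl)⟩
    obtain ⟨v, hv, h⟩ := claim (List.finite_length_eq (Fin a) n).toFinset (by simp)
    refine ⟨v, hv, fun u hu => ?_⟩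
    rcases Nat.lt_succ_iff_lt_or_eq.1 hu with h1 | h1
    · obtain ⟨col, hcol⟩ := hQ u h1
      exact ⟨col, pres u hcol (hv.mono (by omega))⟩
    · exact h u (by simp [h1]))
  have hcol : ∀ u : List (Fin a), ∃ col, ∀ h, RR (a + 1) m h → c (h ∘ sig a u ∘ G) = col := by
    intro u
    obtain ⟨G', v, hG', hQ, hv, rfl⟩ := hn (u.length + 1)
    obtain ⟨col, hcol⟩ := hQ u (by omega)
    exact ⟨col, pres u hcol (hv.mono (by omega))⟩
  choose colr hcolr using hcol
  obtain ⟨G2, hG2, col, hcs⟩ := cs_lemma a ha colr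
  refine ⟨G2 ∘ G, hG2.comp hG, col, fun f hf => ?_⟩
  have hex := hf.2.2.1 a ham
  have hp := Nat.find_spec hex
  have hmin : ∀ j < Nat.find hex, f j ≠ a := fun j hj => Nat.find_min hex hj
  set p := Nat.find hex
  have hap : a ≤ p := by
    by_contra hc
    have := hf.2.2.2 p (by omega)
    omega
  have hlow : ∀ j < p, f j < a := by
    intro j hj
    rcases lt_trichotomy (f j) a with h | h | h
    · exact h
    · exact absurd h (hmin j hj)
    · obtain ⟨j', hj', e'⟩ := hf.1 _ _ h
      exact absurd e' (hmin j' (by omega))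
  obtain ⟨q, hq1, hq2, hq3⟩ := hcs (p - a)
  rw [show a + (p - a) = p by omega] at hq1 hq2
  let s : ℕ → Fin a := fun i => if h : f i < a then ⟨f i, h⟩ else ⟨0, ha⟩
  have hs : ∀ i : Fin a, s i = i := by
    intro i
    have := hf.2.2.2 i i.2
    simp [s, this]
  have hs2 : ∀ i < p, (s i : ℕ) = f i := by
    intro i hi
    simp [s, hlow i hi]
  set u := (List.range q).map fun i => s (G2 (a + i)) with hu
  have hul : u.length = q := by simp [hu]
  obtain ⟨h, hh, e⟩ := factor u (hf.comp hG2) (by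
    intro i hi
    simp only [hu, List.getElem_map, List.getElem_range, Function.comp_apply]
    rw [hs2 _ (hq2 i (by omega))]) (by
    rw [hul, Function.comp_apply, hq1, hp])
  rw [← Function.comp_assoc, e, Function.comp_assoc, hcolr u h hh]
  exact hq3 s hs

end main

section base

open Topology Filter

/-- The set of infinite sequences extending a finite word. -/
def cyl {a : ℕ} (w : List (Fin a)) : Set (ℕ → Fin a) := {x | ∀ i (h : i < w.length), x i = w[i]}

lemma cyl_open {a : ℕ} (w : List (Fin a)) : IsOpen (cyl w) := by
  have : cyl w = ⋂ i : Fin w.length, (fun x : ℕ → Fin a => x i) ⁻¹' {w[i]} := by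
    ext x
    simp only [cyl, Set.mem_iInter, Set.mem_preimage, Set.mem_singleton_iff]
    exact ⟨fun h i => h i i.2, fun h i hi => h ⟨i, hi⟩⟩
  rw [this]
  exact isOpen_iInter_of_finite fun i => (isOpen_discrete _).preimage (continuous_apply _)

lemma exists_cyl {a : ℕ} {D : Set (ℕ → Fin a)} (hD : IsOpen D) {x : ℕ → Fin a} (hx : x ∈ D)
    (N : ℕ) : ∃ l ≥ N, cyl ((List.range l).map x) ⊆ D := by
  obtain ⟨I, U, hU, hs⟩ := isOpen_pi_iff.1 hD x hx
  refine ⟨max N (I.sup id + 1), le_max_left _ _, fun y hy => hs ?_⟩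
  intro i hi
  have h1 : i ≤ I.sup id := Finset.le_sup (f := id) hi
  have := hy i (by simp; omega)
  simp only [List.getElem_map, List.getElem_range] at this
  rw [this]
  exact (hU i hi).2

lemma cyl_mono {a : ℕ} (w r : List (Fin a)) : cyl (w ++ r) ⊆ cyl w := by
  intro x hx i hi
  rw [hx i (by simp; omega), List.getElem_append_left hi]

lemma dense_ext {a : ℕ} (ha : 0 < a) {D : Set (ℕ → Fin a)} (hD : IsOpen D) (hd : Dense D)
    (w : List (Fin a)) : ∃ r, cyl (w ++ r) ⊆ D := by
  have hne : (cyl w).Nonempty := ⟨fun i => if h : i < w.length then w[i] else ⟨0, ha⟩, by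
    intro i hi; simp [hi]⟩
  obtain ⟨x, hx1, hx2⟩ := hd.inter_open_nonempty _ (cyl_open w) hne
  obtain ⟨l, hl, hs⟩ := exists_cyl hD hx2 w.length
  refine ⟨((List.range l).map x).drop w.length, ?_⟩
  convert hs
  conv_rhs => rw [← List.take_append_drop w.length ((List.range l).map x)]
  congr 1
  apply List.ext_getElem
  · simp; omega
  · intro i h1 h2
    simp [hx1 i h1]

lemma dense_ext_fin {a : ℕ} (ha : 0 < a) {D : Set (ℕ → Fin a)} (hD : IsOpen D) (hd : Dense D)
    (F : Finset (List (Fin a))) : ∃ r, ∀ w ∈ F, cyl (w ++ r) ⊆ D := by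
  classical
  induction F using Finset.induction_on with
  | empty => exact ⟨[], by simp⟩
  | insert w F hw ih =>
    obtain ⟨r, hr⟩ := ih
    obtain ⟨r', hr'⟩ := dense_ext ha hD hd (w ++ r)
    refine ⟨r ++ r', fun u hu => ?_⟩
    rw [← List.append_assoc]
    rcases Finset.mem_insert.1 hu with rfl | hu
    · exact hr'
    · exact (cyl_mono _ _).trans (hr u hu)

lemma ram_base (a : ℕ) (ha : 0 < a) : Ram a a := by
  classical
  intro k c hc
  have : NeZero a := ⟨by omega⟩
  let io : (ℕ → Fin a) → ℕ → ℕ := fun x i => if i < a then i else (x (i - a) : ℕ)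
  have hio : Measurable io := by
    refine measurable_pi_lambda _ fun i => ?_
    by_cases h : i < a
    · simp only [io, h, if_true]; exact measurable_const
    · simp only [io, h, if_false]
      exact (measurable_of_countable (fun y : Fin a => (y : ℕ))).comp (measurable_pi_apply _)
  have hci : ∀ col, MeasurableSet ((c ∘ io) ⁻¹' {col}) := fun col =>
    (hc.comp hio) (MeasurableSet.singleton _)
  choose U hUo hU using fun col => (hci col).residualEq_isOpen
  obtain ⟨col, x0, hx0⟩ : ∃ col, (U col).Nonempty := by
    by_contra hcon
    push Not at hcon
    have h1 : ∀ᶠ x in residual (ℕ → Fin a), ∀ col, ¬ (c (io x) = col) := by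
      rw [eventually_all]
      intro col
      have := hU col
      rw [hcon col, Filter.eventuallyEq_set] at this
      filter_upwards [this] with x hx
      simpa using hx
    have h2 := (dense_of_mem_residual h1).nonempty
    obtain ⟨x, hx⟩ := h2
    exact hx _ rfl
  obtain ⟨l, -, hl⟩ := exists_cyl (hUo col) hx0 0
  set t := (List.range l).map x0
  have hres := Filter.eventuallyEq_set.1 (hU col)
  obtain ⟨S, hS1, hS2, hS3, hS4⟩ := mem_residual_iff.1 hres
  obtain ⟨D, hD⟩ : ∃ D : ℕ → Set (ℕ → Fin a), insert Set.univ S = Set.range D :=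
    (hS3.insert _).exists_eq_range (Set.insert_nonempty _ _)
  have hD1 : ∀ n, IsOpen (D n) ∧ Dense (D n) := by
    intro n
    have : D n ∈ insert Set.univ S := hD ▸ Set.mem_range_self n
    rcases this with h | h
    · rw [h]; exact ⟨isOpen_univ, dense_univ⟩
    · exact ⟨hS1 _ h, hS2 _ h⟩
  obtain ⟨G, hG, h⟩ := tree a (fun n w => cyl w ⊆ cyl t ∧ ∀ j < n, cyl w ⊆ D j)
    ⟨t, subset_rfl, fun j hj => absurd hj (by omega)⟩ (by
      intro n F hF
      obtain ⟨r, hr⟩ := dense_ext_fin ha (hD1 n).1 (hD1 n).2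
        ((F ×ˢ (Finset.univ : Finset (Fin a))).image fun p => p.1 ++ [p.2])
      refine ⟨r.map some, fun w hw b => ?_⟩
      have e : w ++ b :: (r.map some).map (fun o => o.getD b) = (w ++ [b]) ++ r := by
        simp
      have hsub : cyl ((w ++ [b]) ++ r) ⊆ cyl w := (cyl_mono _ _).trans (cyl_mono _ _)
      rw [e]
      refine ⟨hsub.trans (hF w hw).1, fun j hj => ?_⟩
      rcases Nat.lt_succ_iff_lt_or_eq.1 hj with h | rfl
      · exact hsub.trans ((hF w hw).2 j h)
      · exact hr _ (Finset.mem_image.2 ⟨(w, b), by simp [hw], rfl⟩))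
  refine ⟨G, hG, col, fun f hf => ?_⟩
  let s : ℕ → Fin a := fun i => ⟨f i, hf.2.1 i⟩
  have hs : ∀ i : Fin a, s i = i := fun i => Fin.ext (hf.2.2.2 i i.2)
  let x : ℕ → Fin a := fun i => s (G (a + i))
  have hx : io x = f ∘ G := by
    funext i
    by_cases hi : i < a
    · simp [io, hi, hG.2.2 i hi, hf.2.2.2 i hi]
    · simp only [io, hi, if_false, x, s, Function.comp_apply]
      rw [show a + (i - a) = i by omega]
  have hmem : ∀ q, x ∈ cyl ((List.range q).map fun i => s (G (a + i))) := by
    intro q i hi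
    simp [x]
  have hxU : x ∈ U col := by
    obtain ⟨q, -, -, h3⟩ := h 0
    exact hl ((h3 s hs).1 (hmem q))
  have hxD : ∀ n, x ∈ D n := by
    intro n
    obtain ⟨q, -, -, h3⟩ := h (n + 1)
    exact (h3 s hs).2 n (by omega) (hmem q)
  have hxS : x ∈ ⋂₀ S := by
    intro T hT
    have : T ∈ Set.range D := hD ▸ Set.mem_insert_of_mem _ hT
    obtain ⟨n, rfl⟩ := this
    exact hxD n
  have := (hS4 hxS).2 hxU
  rw [← hx]
  exact this

lemma ram (m : ℕ) (d : ℕ) : ∀ a, 0 < a → a + d = m → Ram a m := by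
  induction d with
  | zero => intro a ha h; rw [← h]; exact ram_base a ha
  | succ d ih => intro a ha h; exact ram_step a m ha (by omega) (ih (a + 1) (by omega) (by omega))

lemma ram_family {ι : Type} [Finite ι] (m : ι → ℕ) (k : ℕ) (c : ι → (ℕ → ℕ) → Fin k) (hk : 0 < k)
    (hc : ∀ t, Measurable (c t)) :
    ∃ G, WW 1 G ∧ ∀ t, ∃ col : Fin k, ∀ h, RR 1 (m t) h → c t (h ∘ G) = col := by
  classical
  have := Fintype.ofFinite ι
  suffices H : ∀ F : Finset ι, ∃ G, WW 1 G ∧ ∀ t ∈ F, ∃ col : Fin k,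
      ∀ h, RR 1 (m t) h → c t (h ∘ G) = col by
    obtain ⟨G, hG, h⟩ := H Finset.univ
    exact ⟨G, hG, fun t => h t (Finset.mem_univ _)⟩
  intro F
  induction F using Finset.induction_on with
  | empty => exact ⟨id, WW.id _, by simp⟩
  | insert t F ht ih =>
    obtain ⟨G, hG, hF⟩ := ih
    by_cases hm : m t = 0
    · refine ⟨G, hG, fun t' ht' => ?_⟩
      rcases Finset.mem_insert.1 ht' with rfl | ht'
      · refine ⟨⟨0, hk⟩, fun h hh => ?_⟩
        have := hh.2.1 0
        omega
      · exact hF t' ht'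
    obtain ⟨G', hG', col, hcol⟩ := ram (m t) (m t - 1) 1 one_pos (by omega) k
      (fun h => c t (h ∘ G)) ((hc t).comp (comp_meas G))
    refine ⟨G' ∘ G, hG'.comp hG, fun t' ht' => ?_⟩
    rcases Finset.mem_insert.1 ht' with rfl | ht'
    · exact ⟨col, hcol⟩
    · obtain ⟨col', h'⟩ := hF t' ht'
      exact ⟨col', fun h hh => h' _ (hh.comp hG')⟩

end base

section final

/-- The linear order on the edges. -/
noncomputable def edgeOrder (B : EODigraph) : LinearOrder B.Edge :=
  haveI := B.lin
  { le := B.ele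
    le_refl := fun x => refl_of B.ele x
    le_trans := fun x y z h1 h2 => trans_of B.ele h1 h2
    le_antisymm := fun x y h1 h2 => antisymm_of B.ele h1 h2
    le_total := fun x y => total_of B.ele x y
    toDecidableLE := Classical.decRel _ }

lemma exists_enum (B : EODigraph) (I : Set B.Edge) : ∃ (m : ℕ) (e : Fin m ≃ I),
    ∀ i j, i < j → B.elt (e i).1 (e j).1 := by
  classical
  letI := edgeOrder B
  haveI := B.finite
  haveI : Finite B.Edge := Subtype.finite
  haveI := Fintype.ofFinite I
  refine ⟨Fintype.card I, (Fintype.orderIsoFinOfCardEq I rfl).toEquiv, fun i j hij => ?_⟩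
  have h : (Fintype.orderIsoFinOfCardEq I rfl i) < (Fintype.orderIsoFinOfCardEq I rfl j) :=
    (OrderIso.lt_iff_lt _).2 hij
  have h' : (Fintype.orderIsoFinOfCardEq I rfl i).1 < (Fintype.orderIsoFinOfCardEq I rfl j).1 := h
  exact ⟨h'.le, h'.ne⟩

/-- Edges which have to be hit by a map of type `T`. -/
def typ (B : EODigraph) (T : Set B.V) : Set B.Edge :=
  {e | e.1.1 ≠ e.1.2 ∨ IsIsolated B.rel e.1.1 ∨ e.1.1 ∈ T}

lemma borel_pre {V : Type} (A : Set (ℕ × Bool → V))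
    (hA : @MeasurableSet _ (@borel (ℕ × Bool → V)
          (@Pi.topologicalSpace (ℕ × Bool) (fun _ => V) (fun _ => ⊥))) A)
    (en : ℕ → V × V) :
    MeasurableSet ((fun (h : ℕ → ℕ) (p : ℕ × Bool) =>
      if p.2 = true then (en (h p.1)).2 else (en (h p.1)).1) ⁻¹' A) := by
  letI : TopologicalSpace V := ⊥
  haveI : DiscreteTopology V := ⟨rfl⟩
  letI : MeasurableSpace (ℕ × Bool → V) := borel _
  haveI : BorelSpace (ℕ × Bool → V) := ⟨rfl⟩
  refine Continuous.measurable (continuous_pi fun p => ?_) hA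
  have : (fun h : ℕ → ℕ => if p.2 = true then (en (h p.1)).2 else (en (h p.1)).1) =
      (fun i : ℕ => if p.2 = true then (en i).2 else (en i).1) ∘ fun h => h p.1 := rfl
  rw [this]
  exact continuous_of_discreteTopology.comp (continuous_apply _)

lemma qr_code (B : EODigraph) (f : ℕ × Bool → B.V) (hf : QRMapTo B f) :
    ∃ T ⊆ {v | ¬ IsIsolated B.rel v}, ∀ (m : ℕ) (e : Fin m ≃ typ B T),
      (∀ i j, i < j → B.elt (e i).1 (e j).1) →
      ∃ h : ℕ → ℕ, RR 1 m h ∧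
        ∀ n, ∃ hn : h n < m, (e ⟨h n, hn⟩).1.1 = (f (n, false), f (n, true)) := by
  classical
  obtain ⟨⟨hsu, hrel, hquot⟩, hrig⟩ := hf
  let ed : ℕ → B.Edge := fun n => ⟨(f (n, false), f (n, true)), hrel _ _ (Or.inr ⟨rfl, rfl, rfl⟩)⟩
  refine ⟨{v | ¬ IsIsolated B.rel v ∧ ∃ n, f (n, false) = v ∧ f (n, true) = v},
    fun v hv => hv.1, ?_⟩
  set T : Set B.V := {v | ¬ IsIsolated B.rel v ∧ ∃ n, f (n, false) = v ∧ f (n, true) = v}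
  intro m e he
  have h1 : ∀ n, ed n ∈ typ B T := by
    intro n
    by_cases hl : f (n, false) = f (n, true)
    · by_cases hi : IsIsolated B.rel (f (n, false))
      · exact Or.inr (Or.inl hi)
      · exact Or.inr (Or.inr ⟨hi, n, rfl, hl.symm⟩)
    · exact Or.inl hl
  have h2 : ∀ d ∈ typ B T, ∃ n, ed n = d := by
    rintro ⟨⟨u, v⟩, huv⟩ hd
    by_cases hl : u = v
    · subst hl
      rcases hd with hd | hd | hd
      · exact absurd rfl hd
      · change IsIsolated B.rel u at hd
        obtain ⟨⟨n, b⟩, hx⟩ := hsu u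
        refine ⟨n, Subtype.ext (Prod.ext ?_ ?_)⟩
        · change f (n, false) = u
          by_contra hne
          have hr := (ed n).2
          change B.rel (f (n, false)) (f (n, true)) at hr
          cases b with
          | false => exact hne hx
          | true => rw [hx] at hr; exact (hd _ hne).2 hr
        · change f (n, true) = u
          by_contra hne
          have hr := (ed n).2
          change B.rel (f (n, false)) (f (n, true)) at hr
          cases b with
          | true => exact hne hx
          | false => rw [hx] at hr; exact (hd _ hne).1 hr
      · obtain ⟨-, n, e1, e2⟩ := hd
        exact ⟨n, Subtype.ext (Prod.ext e1 e2)⟩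
    · obtain ⟨⟨x, a⟩, ⟨y, b⟩, hr, e1, e2⟩ := hquot u v huv
      rcases hr with hr | ⟨q1, q2, q3⟩
      · exact absurd (by rw [← e1, ← e2, hr]) hl
      · simp only at q1 q2 q3
        subst q1 q2 q3
        exact ⟨x, Subtype.ext (Prod.ext e1 e2)⟩
  let h : ℕ → ℕ := fun n => (e.symm ⟨ed n, h1 n⟩ : ℕ)
  have hh : ∀ n, e ⟨h n, (e.symm ⟨ed n, h1 n⟩).2⟩ = ⟨ed n, h1 n⟩ := fun n => by simp [h]
  have hsurj : ∀ b < m, ∃ i, h i = b := by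
    intro b hb
    obtain ⟨n, hn⟩ := h2 _ (e ⟨b, hb⟩).2
    refine ⟨n, ?_⟩
    have : (⟨ed n, h1 n⟩ : typ B T) = e ⟨b, hb⟩ := Subtype.ext hn
    simp [h, this]
  have hRG : RG h := by
    intro i b hb
    have hbm : b < m := hb.trans (e.symm ⟨ed i, h1 i⟩).2
    have helt := he ⟨b, hbm⟩ ⟨h i, (e.symm ⟨ed i, h1 i⟩).2⟩ hb
    rw [hh i] at helt
    obtain ⟨n, hn⟩ := h2 _ (e ⟨b, hbm⟩).2
    have key := hrig _ _ helt ⟨n, congrArg Subtype.val hn⟩ ⟨i, rfl⟩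
    have hne : {n : ℕ | (f (n, false), f (n, true)) = (e ⟨b, hbm⟩).1.1}.Nonempty :=
      ⟨n, congrArg Subtype.val hn⟩
    have hmem := Nat.sInf_mem hne
    refine ⟨_, lt_of_lt_of_le key (Nat.sInf_le rfl), ?_⟩
    set j := sInf {n : ℕ | (f (n, false), f (n, true)) = (e ⟨b, hbm⟩).1.1}
    have : (⟨ed j, h1 j⟩ : typ B T) = e ⟨b, hbm⟩ := Subtype.ext (Subtype.ext hmem)
    simp [h, this]
  refine ⟨h, ⟨hRG, fun i => (e.symm ⟨ed i, h1 i⟩).2, hsurj, fun i hi => ?_⟩, fun n => ?_⟩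
  · have := hRG.le i
    omega
  · exact ⟨(e.symm ⟨ed n, h1 n⟩).2, by rw [hh]⟩

end final

end CS

/-- The dual big Ramsey degree bound for a finite edge-ordered reflexive digraph `B`
with `n` vertices, `p` of which are isolated, in the edge-ordered `ω·A₂`, with
respect to quotient rigid maps and Borel colorings, is at most `2^(n-p)`. -/
theorem stmt_14 (B : EODigraph) (n p : ℕ)
    (hn : (Set.univ : Set B.V).ncard = n)
    (hp : {v : B.V | IsIsolated B.rel v}.ncard = p)
    (k : ℕ) (hk : 1 ≤ k)
    (χ : {f : ℕ × Bool → B.V // QRMapTo B f} → Fin k)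
    (hχ : ∀ i : Fin k,
      @MeasurableSet _
        (@borel (ℕ × Bool → B.V)
          (@Pi.topologicalSpace (ℕ × Bool) (fun _ => B.V) (fun _ => ⊥)))
        (Subtype.val '' (χ ⁻¹' {i}))) :
    ∃ w : ℕ × Bool → ℕ × Bool, IsQuot omegaA2 omegaA2 w ∧
      (∃ ν : ℕ → ℕ,
        (∀ j : ℕ, w (j, false) = (ν j, false) ∧ w (j, true) = (ν j, true)) ∧
        Function.Surjective ν ∧
        ∀ b₁ b₂ : ℕ, b₁ < b₂ → sInf {j : ℕ | ν j = b₁} < sInf {j : ℕ | ν j = b₂}) ∧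
      {c : Fin k | ∃ g : {f : ℕ × Bool → B.V // QRMapTo B f},
          (∃ f : ℕ × Bool → B.V, QRMapTo B f ∧ g.1 = f ∘ w) ∧ χ g = c}.ncard ≤
        2 ^ (n - p) := by
  classical
  haveI := B.finite
  choose m e he using fun T => CS.exists_enum B (CS.typ B T)
  -- it suffices to work with a rigid surjection of the index set
  suffices H : ∃ G, CS.WW 1 G ∧ ∃ col : Set B.V → Fin k,
      ∀ f : ℕ × Bool → B.V, QRMapTo B f → ∀ g : {f : ℕ × Bool → B.V // QRMapTo B f},
        g.1 = f ∘ (fun x => (G x.1, x.2)) →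
        ∃ T ⊆ {v | ¬ IsIsolated B.rel v}, χ g = col T by
    obtain ⟨G, ⟨hRG, hsu, -⟩, col, hcol⟩ := H
    refine ⟨fun x => (G x.1, x.2), ⟨?_, ?_, ?_⟩, ⟨G, fun j => ⟨rfl, rfl⟩, hsu, ?_⟩, ?_⟩
    · rintro ⟨x, b⟩
      obtain ⟨y, rfl⟩ := hsu x
      exact ⟨(y, b), rfl⟩
    · rintro x y (rfl | ⟨h1, h2, h3⟩)
      · exact Or.inl rfl
      · exact Or.inr ⟨congrArg G h1, h2, h3⟩
    · rintro ⟨u, a⟩ ⟨v, b⟩ (h | ⟨h1, h2, h3⟩)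
      · obtain ⟨y, hy⟩ := hsu u
        exact ⟨(y, a), (y, a), Or.inl rfl, by simp [hy], by rw [← h]; simp [hy]⟩
      · simp only at h1 h2 h3
        subst h1 h2 h3
        obtain ⟨y, rfl⟩ := hsu u
        exact ⟨(y, false), (y, true), Or.inr ⟨rfl, rfl, rfl⟩, rfl, rfl⟩
    · intro b₁ b₂ hb
      have hmem : G (sInf {j : ℕ | G j = b₂}) = b₂ := Nat.sInf_mem (s := {j : ℕ | G j = b₂}) (hsu b₂)
      obtain ⟨j, hj, e⟩ := hRG _ b₁ (by rw [hmem]; exact hb)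
      exact lt_of_le_of_lt (Nat.sInf_le e) hj
    · have hsub : {c : Fin k | ∃ g : {f : ℕ × Bool → B.V // QRMapTo B f},
          (∃ f : ℕ × Bool → B.V, QRMapTo B f ∧ g.1 = f ∘ (fun x : ℕ × Bool => (G x.1, x.2))) ∧
            χ g = c} ⊆ col '' (𝒫 {v | ¬ IsIsolated B.rel v}) := by
        rintro c ⟨g, ⟨f, hf, hg⟩, rfl⟩
        obtain ⟨T, hT, e⟩ := hcol f hf g hg
        exact ⟨T, hT, e.symm⟩
      refine (Set.ncard_le_ncard hsub (Set.toFinite _)).trans ?_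
      refine (Set.ncard_image_le (Set.toFinite _)).trans ?_
      rw [Set.ncard_powerset _ (Set.toFinite _)]
      have : {v | ¬ IsIsolated B.rel v} = {v | IsIsolated B.rel v}ᶜ := rfl
      rw [this, Set.ncard_compl, hp, ← Set.ncard_univ, hn]
  rcases isEmpty_or_nonempty B.V with hV | ⟨⟨v0⟩⟩
  · exact ⟨id, CS.WW.id 1, fun _ => ⟨0, hk⟩, fun f => (hV.false (f (0, false))).elim⟩
  let en : Set B.V → ℕ → B.V × B.V := fun T i =>
    if h : i < m T then (e T ⟨i, h⟩).1.1 else (v0, v0)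
  let fh : Set B.V → (ℕ → ℕ) → (ℕ × Bool → B.V) := fun T h p =>
    if p.2 = true then (en T (h p.1)).2 else (en T (h p.1)).1
  let c : Set B.V → (ℕ → ℕ) → Fin k := fun T h =>
    if hq : QRMapTo B (fh T h) then χ ⟨fh T h, hq⟩ else ⟨0, hk⟩
  have hc : ∀ T, Measurable (c T) := by
    intro T
    refine measurable_to_countable' fun i => ?_
    have hpre : ∀ j, MeasurableSet (fh T ⁻¹' (Subtype.val '' (χ ⁻¹' {j}))) := fun j =>
      CS.borel_pre _ (hχ j) (en T)
    have : c T ⁻¹' {i} = fh T ⁻¹' (Subtype.val '' (χ ⁻¹' {i})) ∪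
        ({_h | i = ⟨0, hk⟩} ∩ ⋂ j, (fh T ⁻¹' (Subtype.val '' (χ ⁻¹' {j})))ᶜ) := by
      ext h
      by_cases hq : QRMapTo B (fh T h)
      · have : (∃ x, ∃ (_ : QRMapTo B (fh T h)), x = χ ⟨fh T h, hq⟩) := ⟨_, hq, rfl⟩
        simp [c, hq]
      · simp [c, hq, eq_comm]
    rw [this]
    exact (hpre i).union ((MeasurableSet.const _).inter (MeasurableSet.iInter fun j => (hpre j).compl))
  obtain ⟨G, hG, hcol⟩ := CS.ram_family m k c hk hc
  choose col hcol using hcol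
  refine ⟨G, hG, col, fun f hf g hg => ?_⟩
  obtain ⟨T, hT, hcode⟩ := CS.qr_code B f hf
  obtain ⟨h, hR, hh⟩ := hcode (m T) (e T) (he T)
  refine ⟨T, hT, ?_⟩
  have e1 : fh T (h ∘ G) = g.1 := by
    rw [hg]
    funext ⟨i, b⟩
    obtain ⟨hlt, hE⟩ := hh (G i)
    cases b <;> simp [fh, en, hlt, hE]
  rw [← hcol T h hR]
  have hq : QRMapTo B (fh T (h ∘ G)) := e1 ▸ g.2
  simp only [c, dif_pos hq]
  congr 1
  exact Subtype.ext e1.symm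
end
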